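/- arXiv:2207.03165 — 2 statements merged into one kernel-verified Lean document; each statement's English description precedes it below -/
import Mathlib

section
/- For natural numbers n, l ≥ 2, every element σ ∈ A_n is a product of three l-cycles of S_n if and only if l is odd and either ⌈n/2⌉ ≤ l ≤ n, or n = 7 and l = 3. -/
open Equiv

/-- `σ ∈ S_n` is a product of `k` many `l`-cycles. -/
def IsProdOfCycles (n k l : ℕ) (σ : Equiv.Perm (Fin n)) : Prop :=
  ∃ c : Fin k → Equiv.Perm (Fin n),
    (∀ i, (c i).IsCycle ∧ (c i).support.card = l) ∧ σ = (List.ofFn c).prod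


/-- `σ` is the cycle through a nodup list with carrier `S` (possibly trivial). -/
def CycOn {n : ℕ} (S : Finset (Fin n)) (σ : Equiv.Perm (Fin n)) : Prop :=
  ∃ L : List (Fin n), L.Nodup ∧ L.toFinset = S ∧ L.formPerm = σ

lemma formPerm_glue {α : Type*} [DecidableEq α] (u : List α) (x : α) (v : List α) :
    (u ++ x :: v).formPerm = (u ++ [x]).formPerm * (x :: v).formPerm := by
  induction u with
  | nil => simp
  | cons a u ih =>
    cases u with
    | nil => simp [List.formPerm_cons_cons]
    | cons b u =>
      simp only [List.cons_append, List.formPerm_cons_cons] at ih ⊢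
      rw [ih, mul_assoc]

lemma CycOn.head {n : ℕ} {S : Finset (Fin n)} {σ : Equiv.Perm (Fin n)} (h : CycOn S σ) {x : Fin n}
    (hx : x ∈ S) : ∃ v : List (Fin n), (x :: v).Nodup ∧ (x :: v).toFinset = S ∧
      (x :: v).formPerm = σ := by
  obtain ⟨L, h1, h2, h3⟩ := h
  subst h2
  rw [List.mem_toFinset] at hx
  obtain ⟨s, t, rfl⟩ := List.append_of_mem hx
  have hr : (s ++ x :: t) ~r (x :: (t ++ s)) := by
    simpa using (List.isRotated_append (l := s) (l' := x :: t))
  refine ⟨t ++ s, hr.nodup_iff.1 h1, ?_, ?_⟩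
  · ext y; simp only [List.mem_toFinset]; exact hr.mem_iff.symm
  · rw [← h3]; exact (List.formPerm_eq_of_isRotated h1 hr).symm

lemma CycOn.last {n : ℕ} {S : Finset (Fin n)} {σ : Equiv.Perm (Fin n)} (h : CycOn S σ) {x : Fin n}
    (hx : x ∈ S) : ∃ v : List (Fin n), (v ++ [x]).Nodup ∧ (v ++ [x]).toFinset = S ∧
      (v ++ [x]).formPerm = σ := by
  obtain ⟨v, h1, h2, h3⟩ := h.head hx
  have hr := (List.isRotated_concat x v).symm
  refine ⟨v, hr.nodup_iff.1 h1, ?_, ?_⟩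
  · rw [← h2]; ext y; simp only [List.mem_toFinset]; exact hr.mem_iff.symm
  · rw [← h3]; exact (List.formPerm_eq_of_isRotated h1 hr).symm

lemma CycOn.mul {n : ℕ} {S T : Finset (Fin n)} {σ τ : Equiv.Perm (Fin n)} (hs : CycOn S σ)
    (ht : CycOn T τ) {x : Fin n} (hx : S ∩ T = {x}) : CycOn (S ∪ T) (σ * τ) := by
  have hxx : x ∈ S ∩ T := by simp [hx]
  rw [Finset.mem_inter] at hxx
  obtain ⟨u, a1, a2, a3⟩ := hs.last hxx.1
  obtain ⟨v, b1, b2, b3⟩ := ht.head hxx.2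
  have key : ∀ y, y ∈ u → y ∉ x :: v := by
    intro y hy hy2
    have h1 : y ∈ S := by rw [← a2]; simp [hy]
    have h2 : y ∈ T := by rw [← b2, List.mem_toFinset]; exact hy2
    have h3 : y ∈ S ∩ T := Finset.mem_inter.2 ⟨h1, h2⟩
    rw [hx, Finset.mem_singleton] at h3
    subst h3
    simp [List.nodup_append] at a1
    exact a1.2 y hy rfl
  refine ⟨u ++ x :: v, ?_, ?_, ?_⟩
  · rw [List.nodup_append]
    refine ⟨(List.nodup_append.1 a1).1, b1, ?_⟩
    rintro y hy z hz rfl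
    exact key y hy hz
  · rw [← a2, ← b2]; ext y; simp
  · rw [formPerm_glue, a3, b3]

lemma CycOn.card_mul {n : ℕ} {S T : Finset (Fin n)} {x : Fin n} (hx : S ∩ T = {x}) :
    (S ∪ T).card + 1 = S.card + T.card := by
  rw [← Finset.card_union_add_card_inter, hx, Finset.card_singleton]

lemma CycOn.inv {n : ℕ} {S : Finset (Fin n)} {σ : Equiv.Perm (Fin n)} (hs : CycOn S σ) :
    CycOn S σ⁻¹ := by
  obtain ⟨L, h1, h2, h3⟩ := hs
  exact ⟨L.reverse, by simpa using h1, by simpa using h2, by rw [List.formPerm_reverse, h3]⟩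

lemma cycOn_exists {n : ℕ} (S : Finset (Fin n)) : ∃ σ, CycOn S σ :=
  ⟨S.toList.formPerm, S.toList, S.nodup_toList, by simp, rfl⟩

lemma CycOn.isCycle {n : ℕ} {S : Finset (Fin n)} {σ : Equiv.Perm (Fin n)} (h : CycOn S σ)
    (hS : 2 ≤ S.card) : σ.IsCycle ∧ σ.support = S := by
  obtain ⟨L, h1, h2, h3⟩ := h
  subst h2 h3
  rw [List.toFinset_card_of_nodup h1] at hS
  refine ⟨List.isCycle_formPerm h1 hS, List.support_formPerm_of_nodup L h1 ?_⟩
  rintro x rfl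
  simp at hS

lemma cycOn_of_isCycle {n : ℕ} {σ : Equiv.Perm (Fin n)} (h : σ.IsCycle) :
    CycOn σ.support σ := by
  obtain ⟨x, hx, h'⟩ := id h
  refine ⟨σ.toList x, σ.nodup_toList x, ?_, ?_⟩
  · ext y
    rw [List.mem_toFinset, Equiv.Perm.mem_toList_iff, Equiv.Perm.mem_support, Equiv.Perm.mem_support]
    constructor
    · rintro ⟨a, -⟩ hy
      exact hx ((a.apply_eq_self_iff).2 hy)
    · intro hy; exact ⟨h' hy, hx⟩
  · rw [Equiv.Perm.formPerm_toList, h.cycleOf_eq hx]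

lemma CycOn.eq_one {n : ℕ} {S : Finset (Fin n)} {σ : Equiv.Perm (Fin n)} (h : CycOn S σ)
    (hS : S.card ≤ 1) : σ = 1 := by
  obtain ⟨L, h1, h2, h3⟩ := h
  subst h2 h3
  rw [List.toFinset_card_of_nodup h1] at hS
  exact (List.formPerm_eq_one_iff L h1).2 hS

lemma CycOn.support_le {n : ℕ} {S : Finset (Fin n)} {σ : Equiv.Perm (Fin n)} (h : CycOn S σ) :
    σ.support ⊆ S := by
  obtain ⟨L, h1, h2, h3⟩ := h
  subst h2 h3
  exact List.support_formPerm_le L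

lemma CycOn.sqrt {n : ℕ} {S : Finset (Fin n)} {σ : Equiv.Perm (Fin n)} (h : CycOn S σ)
    (hS : Odd S.card) : ∃ e, CycOn S e ∧ e * e = σ := by
  by_cases h1 : S.card ≤ 1
  · exact ⟨σ, h, by rw [h.eq_one h1]; simp⟩
  push Not at h1
  obtain ⟨hc, hs⟩ := h.isCycle h1
  obtain ⟨k, hk⟩ := hS
  have ho : orderOf σ = 2 * k + 1 := by rw [hc.orderOf, hs, hk]
  have hcop : (k + 1).Coprime (orderOf σ) := by
    rw [ho, show 2 * k + 1 = k + 1 * (k + 1) by ring, Nat.coprime_add_mul_right_right]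
    simp
  refine ⟨σ ^ (k + 1), ?_, ?_⟩
  · have := cycOn_of_isCycle (hc.pow_iff.2 hcop)
    rwa [Equiv.Perm.support_pow_coprime hcop, hs] at this
  · rw [← pow_add, show k + 1 + (k + 1) = (2 * k + 1) + 1 by ring, pow_succ, ← ho, pow_orderOf_eq_one,
      one_mul]

lemma CycOn.sign {n : ℕ} {S : Finset (Fin n)} {σ : Equiv.Perm (Fin n)} (h : CycOn S σ)
    (hS : S.Nonempty) : Equiv.Perm.sign σ = 1 ↔ Odd S.card := by
  have h0 := hS.card_pos
  by_cases h1 : S.card ≤ 1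
  · have : S.card = 1 := by omega
    rw [h.eq_one h1, this]; simp
  push Not at h1
  obtain ⟨hc, hs⟩ := h.isCycle h1
  rw [hc.sign, hs]
  rcases Nat.even_or_odd S.card with he | ho
  · simp [he.neg_one_pow, Nat.not_odd_iff_even.2 he]
  · simp [ho.neg_one_pow, ho]

/-- extension set -/
lemma exists_tail {n : ℕ} (S : Finset (Fin n)) {x : Fin n} (hx : x ∈ S) (k : ℕ)
    (hk : S.card + k ≤ n) : ∃ T : Finset (Fin n), S ∩ T = {x} ∧ T.card = k + 1 := by
  have : k ≤ (Sᶜ).card := by rw [Finset.card_compl, Fintype.card_fin]; omega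
  obtain ⟨T, hT, hc⟩ := Finset.exists_subset_card_eq this
  have hxT : x ∉ T := fun h => by simpa [hx] using hT h
  refine ⟨insert x T, ?_, by rw [Finset.card_insert_of_notMem hxT, hc]⟩
  ext y
  simp only [Finset.mem_inter, Finset.mem_insert, Finset.mem_singleton]
  constructor
  · rintro ⟨a, b | b⟩
    · exact b
    · have := hT b; simp [a] at this
  · rintro rfl; exact ⟨hx, Or.inl rfl⟩

lemma two_cycles {n l : ℕ} (hln : l ≤ n) (hl : Odd l) {S : Finset (Fin n)}
    {d : Equiv.Perm (Fin n)} (h : CycOn S d) (hS : Odd S.card) (hSl : S.card ≤ 2 * l) :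
    ∃ a b A B, CycOn A a ∧ CycOn B b ∧ A.card = l ∧ B.card = l ∧ d = a * b := by
  rcases le_or_gt S.card l with hle | hgt
  · obtain ⟨x, hx⟩ : S.Nonempty := by rw [← Finset.card_pos]; exact hS.pos
    obtain ⟨T, hT, hTc⟩ := exists_tail S hx (l - S.card) (by omega)
    obtain ⟨e, he, hee⟩ := h.sqrt hS
    obtain ⟨f, hf⟩ := cycOn_exists T
    have hT' : T ∩ S = {x} := by rw [Finset.inter_comm]; exact hT
    have c1 := CycOn.card_mul hT
    have c2 := CycOn.card_mul hT'
    refine ⟨e * f, f⁻¹ * e, _, _, he.mul hf hT, hf.inv.mul he hT', by omega, by omega, ?_⟩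
    rw [← hee]; group
  · obtain ⟨L, h1, h2, h3⟩ := h
    have hlen : L.length = S.card := by rw [← h2, List.toFinset_card_of_nodup h1]
    obtain ⟨j, hj⟩ := hl
    obtain ⟨i, hi⟩ := hS
    -- split L
    obtain ⟨u, M, w, rfl, hu, hM, hw⟩ : ∃ u M w, L = u ++ (M ++ w) ∧ u.length = S.card - l ∧
        M.length = 2 * l - S.card ∧ w.length = S.card - l := by
      refine ⟨L.take (S.card - l), (L.drop (S.card - l)).take (2 * l - S.card),
        (L.drop (S.card - l)).drop (2 * l - S.card), ?_, ?_, ?_, ?_⟩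
      · simp
      · simp; omega
      · simp; omega
      · simp; omega
    have hMc : M.toFinset.card = 2 * l - S.card := by
      rw [List.toFinset_card_of_nodup, hM]
      exact (List.nodup_append.1 (List.nodup_append.1 h1).2.1).1
    have hM0 : M ≠ [] := by rintro rfl; simp at hM; omega
    obtain ⟨x, v0, hx⟩ := List.exists_cons_of_ne_nil hM0
    obtain ⟨v1, y, hy⟩ : ∃ v1 y, M = v1 ++ [y] := ⟨_, _, (List.dropLast_append_getLast hM0).symm⟩
    have e1 : d = (u ++ [x]).formPerm * M.formPerm * (y :: w).formPerm := by
      have t1 : (u ++ (M ++ w)).formPerm = (u ++ [x]).formPerm * (M ++ w).formPerm := by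
        rw [hx]; exact formPerm_glue u x (v0 ++ w)
      have t2 : (M ++ w).formPerm = M.formPerm * (y :: w).formPerm := by
        rw [hy, List.append_assoc]; exact formPerm_glue v1 y w
      rw [← h3, t1, t2, mul_assoc]
    have hMn : M.Nodup := (List.nodup_append.1 (List.nodup_append.1 h1).2.1).1
    have hun : u.Nodup := (List.nodup_append.1 h1).1
    have hwn : w.Nodup := (List.nodup_append.1 (List.nodup_append.1 h1).2.1).2.1
    have hxM : x ∈ M := by rw [hx]; simp
    have hyM : y ∈ M := by rw [hy]; simp
    have dis1 : ∀ z, z ∈ u → z ∉ M := fun z hz hz' =>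
      (List.nodup_append.1 h1).2.2 z hz z (List.mem_append_left _ hz') rfl
    have dis2 : ∀ z, z ∈ M → z ∉ w := fun z hz hz' =>
      (List.nodup_append.1 (List.nodup_append.1 h1).2.1).2.2 z hz z hz' rfl
    have xu : x ∉ u := fun h => dis1 x h hxM
    have yw : y ∉ w := fun h => dis2 y hyM h
    obtain ⟨e, he, hee⟩ := CycOn.sqrt (S := M.toFinset) (σ := M.formPerm) ⟨M, hMn, rfl, rfl⟩
      (by rw [hMc]; exact ⟨2 * j - i, by omega⟩)
    have nux : (u ++ [x]).Nodup := by
      rw [List.nodup_append]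
      refine ⟨hun, by simp, ?_⟩
      rintro a ha b hb rfl
      simp at hb; subst hb; exact xu ha
    have nyw : (y :: w).Nodup := List.nodup_cons.2 ⟨yw, hwn⟩
    have i1 : (u ++ [x]).toFinset ∩ M.toFinset = {x} := by
      ext z; simp only [Finset.mem_inter, List.mem_toFinset, List.mem_append, List.mem_singleton,
        Finset.mem_singleton]
      constructor
      · rintro ⟨a | a, b⟩
        · exact absurd b (dis1 z a)
        · exact a
      · rintro rfl; exact ⟨Or.inr rfl, hxM⟩
    have i2 : M.toFinset ∩ (y :: w).toFinset = {y} := by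
      ext z; simp only [Finset.mem_inter, List.mem_toFinset, List.mem_cons,
        Finset.mem_singleton]
      constructor
      · rintro ⟨b, a | a⟩
        · exact a
        · exact absurd a (dis2 z b)
      · rintro rfl; exact ⟨hyM, Or.inl rfl⟩
    have c1 := CycOn.card_mul i1
    have c2 := CycOn.card_mul i2
    rw [List.toFinset_card_of_nodup nux, hMc] at c1
    rw [List.toFinset_card_of_nodup nyw, hMc] at c2
    simp only [List.length_append, List.length_cons, List.length_nil] at c1 c2
    refine ⟨_, _, _, _, CycOn.mul ⟨_, nux, rfl, rfl⟩ he i1, CycOn.mul he ⟨_, nyw, rfl, rfl⟩ i2,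
      by omega, by omega, ?_⟩
    rw [e1, ← hee]; group

lemma cyc_split {n : ℕ} (σ : Equiv.Perm (Fin n)) : σ ≠ 1 → ∀ l : ℕ, σ.cycleType.card ≤ l →
    l ≤ σ.support.card → ∃ c d C D p, CycOn C c ∧ CycOn D d ∧ p ∈ C ∧ p ∈ D ∧ C ⊆ σ.support ∧
      D ⊆ σ.support ∧ C.card = l ∧ σ = c * d := by
  induction σ using Equiv.Perm.cycle_induction_on with
  | base_one => intro h; exact absurd rfl h
  | base_cycles σ hσ =>
    intro _ l h1 h2
    rw [hσ.cycleType] at h1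
    simp at h1
    obtain ⟨L, a1, a2, a3⟩ := cycOn_of_isCycle hσ
    have hlen : L.length = σ.support.card := by rw [← a2, List.toFinset_card_of_nodup a1]
    obtain ⟨u, x, v, rfl, hu⟩ : ∃ u x v, L = u ++ x :: v ∧ u.length = l - 1 := by
      have : L.drop (l - 1) ≠ [] := by
        intro h; have := congrArg List.length h; simp at this; omega
      obtain ⟨x, v, hx⟩ := List.exists_cons_of_ne_nil this
      refine ⟨L.take (l - 1), x, v, by rw [← hx]; simp, by simp; omega⟩
    have b1 : (u ++ [x]).Nodup := a1.sublist (by simp)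
    have b2 : (x :: v).Nodup := a1.sublist (by simp)
    refine ⟨_, _, _, _, x, ⟨_, b1, rfl, rfl⟩, ⟨_, b2, rfl, rfl⟩, by simp, by simp, ?_, ?_, ?_, ?_⟩
    · rw [← a2]; intro z; simp; tauto
    · rw [← a2]; intro z; simp; tauto
    · rw [List.toFinset_card_of_nodup b1]; simp; omega
    · rw [← formPerm_glue, a3]
  | induction_disjoint σ τ hd hσ ih1 ih2 =>
    intro _ l h1 h2
    by_cases hτ : τ = 1
    · subst hτ
      rw [mul_one] at *
      exact ih1 hσ.ne_one l h1 h2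
    rw [hd.cycleType_mul, Multiset.card_add, hσ.cycleType, Multiset.card_singleton] at h1
    rw [hd.card_support_mul] at h2
    have hτ2 : τ.cycleType.card ≤ τ.support.card := by
      rw [← Equiv.Perm.sum_cycleType]
      have := Multiset.card_nsmul_le_sum (s := τ.cycleType) (a := 1)
        (fun x hx => (Equiv.Perm.one_lt_of_mem_cycleType hx).le)
      simpa using this
    have hσ2 := hσ.two_le_card_support
    obtain ⟨l1, l2, e, e1, e2, e3, e4⟩ : ∃ l1 l2, l = l1 + l2 ∧ 1 ≤ l1 ∧ l1 ≤ σ.support.card ∧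
        τ.cycleType.card ≤ l2 ∧ l2 ≤ τ.support.card := by
      by_cases hh : l ≤ τ.cycleType.card + σ.support.card
      · exact ⟨l - τ.cycleType.card, τ.cycleType.card, by omega, by omega, by omega, by omega,
          by omega⟩
      · exact ⟨σ.support.card, l - σ.support.card, by omega, by omega, by omega, by omega,
          by omega⟩
    obtain ⟨c, d, C, D, p, hc, hd', pC, pD, hC, hD, cC, rfl⟩ := ih1 hσ.ne_one l1
      (by rw [hσ.cycleType]; simpa using e1) e2
    obtain ⟨c', d', C', D', p', hc', hd'', pC', pD', hC', hD', cC', rfl⟩ := ih2 hτ l2 e3 e4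
    have hdis := Equiv.Perm.disjoint_iff_disjoint_support.1 hd
    rw [Finset.disjoint_left] at hdis
    have hpp : p ≠ p' := fun h => hdis (hC pC) (h ▸ hC' pC')
    set s := Equiv.swap p p' with hs
    have hsC : CycOn {p, p'} s := ⟨[p, p'], by simp [hpp], by ext; simp, by simp [hs]⟩
    have i1 : C' ∩ {p, p'} = {p'} := by
      ext z; simp only [Finset.mem_inter, Finset.mem_insert, Finset.mem_singleton]
      constructor
      · rintro ⟨a, rfl | rfl⟩
        · exact absurd (hC' a) (hdis (hC pC))
        · rfl
      · rintro rfl; exact ⟨pC', Or.inr rfl⟩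
    have i2 : C ∩ (C' ∪ {p, p'}) = {p} := by
      ext z; simp only [Finset.mem_inter, Finset.mem_insert, Finset.mem_singleton, Finset.mem_union]
      constructor
      · rintro ⟨a, b | rfl | rfl⟩
        · exact absurd (hC' b) (hdis (hC a))
        · rfl
        · exact absurd (hC' pC') (hdis (hC a))
      · rintro rfl; exact ⟨pC, Or.inr (Or.inl rfl)⟩
    have i3 : {p, p'} ∩ D = {p} := by
      ext z; simp only [Finset.mem_inter, Finset.mem_insert, Finset.mem_singleton]
      constructor
      · rintro ⟨rfl | rfl, a⟩
        · rfl
        · exact absurd (hC' pC') (hdis (hD a))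
      · rintro rfl; exact ⟨Or.inl rfl, pD⟩
    have i4 : ({p, p'} ∪ D) ∩ D' = {p'} := by
      ext z; simp only [Finset.mem_inter, Finset.mem_insert, Finset.mem_singleton, Finset.mem_union]
      constructor
      · rintro ⟨(rfl | rfl) | b, a⟩
        · exact absurd (hD' a) (hdis (hC pC))
        · rfl
        · exact absurd (hD' a) (hdis (hD b))
      · rintro rfl; exact ⟨Or.inl (Or.inr rfl), pD'⟩
    have k1 := CycOn.card_mul i1
    have k2 := CycOn.card_mul i2
    rw [Finset.card_pair hpp] at k1
    have hcomm : d * c' = c' * d := by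
      apply Equiv.Perm.Disjoint.commute
      rw [Equiv.Perm.disjoint_iff_disjoint_support, Finset.disjoint_left]
      intro z hz hz'
      exact hdis (hD (hd'.support_le hz)) (hC' (hc'.support_le hz'))
    have hsub : ∀ z, z ∈ (c * d).support ∨ z ∈ (c' * d').support →
        z ∈ (c * d * (c' * d')).support := by
      intro z; rw [hd.support_mul, Finset.mem_union]; exact id
    refine ⟨c * (c' * s), s * d * d', _, _, p, hc.mul (hc'.mul hsC i1) i2, (hsC.mul hd' i3).mul hd'' i4,
      by simp, by simp, ?_, ?_, by omega, ?_⟩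
    · intro z hz
      simp only [Finset.mem_insert, Finset.mem_singleton, Finset.mem_union] at hz
      apply hsub
      rcases hz with h | h | rfl | rfl
      · exact Or.inl (hC h)
      · exact Or.inr (hC' h)
      · exact Or.inl (hC pC)
      · exact Or.inr (hC' pC')
    · intro z hz
      simp only [Finset.mem_insert, Finset.mem_singleton, Finset.mem_union] at hz
      apply hsub
      rcases hz with ((rfl | rfl) | h) | h
      · exact Or.inl (hC pC)
      · exact Or.inr (hC' pC')
      · exact Or.inl (hD h)
      · exact Or.inr (hD' h)
    · have hss : s * s = 1 := Equiv.swap_mul_self p p'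
      calc c * d * (c' * d') = c * (d * c') * d' := by group
        _ = c * (c' * d) * d' := by rw [hcomm]
        _ = c * (c' * (s * s) * d) * d' := by rw [hss, mul_one]
        _ = _ := by group

lemma three_of {n l : ℕ} (hl : 2 ≤ l) {a b c : Equiv.Perm (Fin n)} {A B C : Finset (Fin n)}
    (ha : CycOn A a) (hb : CycOn B b) (hc : CycOn C c) (hA : A.card = l) (hB : B.card = l)
    (hC : C.card = l) : IsProdOfCycles n 3 l (a * b * c) := by
  refine ⟨![a, b, c], ?_, by simp [mul_assoc]⟩
  have h1 := ha.isCycle (by omega)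
  have h2 := hb.isCycle (by omega)
  have h3 := hc.isCycle (by omega)
  intro i
  fin_cases i
  · exact ⟨h1.1, by simpa [h1.2] using hA⟩
  · exact ⟨h2.1, by simpa [h2.2] using hB⟩
  · exact ⟨h3.1, by simpa [h3.2] using hC⟩

lemma main_if {n l : ℕ} (hl2 : 2 ≤ l) (hln : l ≤ n) (hl : Odd l) (σ : Equiv.Perm (Fin n))
    (hσ : Equiv.Perm.sign σ = 1) (hc : σ.cycleType.card ≤ l) (hs : σ.support.card ≤ 2 * l) :
    IsProdOfCycles n 3 l σ := by
  suffices H : ∃ c d C D, CycOn C c ∧ CycOn D d ∧ D.Nonempty ∧ C.card = l ∧ D.card ≤ 2 * l ∧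
      σ = c * d by
    obtain ⟨c, d, C, D, hC, hD, hD0, cC, cD, rfl⟩ := H
    have s1 : Equiv.Perm.sign c = 1 := (hC.sign (by rw [← Finset.card_pos]; omega)).2 (cC ▸ hl)
    have s2 : Equiv.Perm.sign d = 1 := by simpa [s1] using hσ
    obtain ⟨a, b, A, B, ha, hb, cA, cB, rfl⟩ := two_cycles hln hl hD ((hD.sign hD0).1 s2) cD
    rw [← mul_assoc]
    exact three_of hl2 hC ha hb cC cA cB
  by_cases h1 : σ = 1
  · obtain ⟨S, -, hS⟩ := Finset.exists_subset_card_eq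
      (s := (Finset.univ : Finset (Fin n))) (n := l) (by simpa using hln)
    obtain ⟨f, hf⟩ := cycOn_exists S
    refine ⟨f, f⁻¹, S, S, hf, hf.inv, by rw [← Finset.card_pos]; omega, hS, by omega, by simp [h1]⟩
  rcases le_or_gt l σ.support.card with hle | hgt
  · obtain ⟨c, d, C, D, p, hC, hD, pC, pD, -, hDs, cC, e⟩ := cyc_split σ h1 l hc hle
    exact ⟨c, d, C, D, hC, hD, ⟨p, pD⟩, cC, (Finset.card_le_card hDs).trans hs, e⟩
  · have hτ2 : σ.cycleType.card ≤ σ.support.card := by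
      rw [← Equiv.Perm.sum_cycleType]
      have := Multiset.card_nsmul_le_sum (s := σ.cycleType) (a := 1)
        (fun x hx => (Equiv.Perm.one_lt_of_mem_cycleType hx).le)
      simpa using this
    obtain ⟨c, d, C, D, p, hC, hD, pC, pD, hCs, hDs, cC, e⟩ :=
      cyc_split σ h1 σ.support.card hτ2 le_rfl
    obtain ⟨T, hT, cT⟩ := exists_tail σ.support (hCs pC) (l - σ.support.card) (by omega)
    have hpT : p ∈ T := by
      have : p ∈ σ.support ∩ T := by simp [hT]
      exact (Finset.mem_inter.1 this).2
    have i1 : C ∩ T = {p} := by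
      apply Finset.Subset.antisymm
      · rw [← hT]; exact Finset.inter_subset_inter_right hCs
      · simp [pC, hpT]
    have i2 : T ∩ D = {p} := by
      rw [Finset.inter_comm]
      apply Finset.Subset.antisymm
      · rw [← hT]; exact Finset.inter_subset_inter_right hDs
      · simp [pD, hpT]
    obtain ⟨f, hf⟩ := cycOn_exists T
    have k1 := CycOn.card_mul i1
    have k2 := CycOn.card_mul i2
    have k3 := Finset.card_le_card hDs
    refine ⟨c * f, f⁻¹ * d, _, _, hC.mul hf i1, hf.inv.mul hD i2, ⟨p, by simp [pD]⟩, by omega,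
      by omega, ?_⟩
    rw [e]; group

lemma two_card_le {n : ℕ} (σ : Equiv.Perm (Fin n)) : 2 * σ.cycleType.card ≤ σ.support.card := by
  rw [← Equiv.Perm.sum_cycleType]
  have := Multiset.card_nsmul_le_sum (s := σ.cycleType) (a := 2)
    (fun x hx => (Equiv.Perm.two_le_of_mem_cycleType hx))
  simp only [smul_eq_mul] at this
  omega

lemma cycleType_list {n : ℕ} (L : List (Fin n)) (h : L.Nodup) (h2 : 2 ≤ L.length) :
    L.formPerm.cycleType = {L.length} := by
  have hc : L.toFinset.card = L.length := List.toFinset_card_of_nodup h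
  obtain ⟨a, b⟩ := CycOn.isCycle (S := L.toFinset) ⟨L, h, rfl, rfl⟩ (by omega)
  rw [a.cycleType, b, hc]

lemma IsProdOfCycles.conj {n l : ℕ} {σ : Equiv.Perm (Fin n)} (h : IsProdOfCycles n 3 l σ)
    (π : Equiv.Perm (Fin n)) : IsProdOfCycles n 3 l (π * σ * π⁻¹) := by
  obtain ⟨c, h1, rfl⟩ := h
  refine ⟨fun i => π * c i * π⁻¹, fun i => ⟨(h1 i).1.conj, by
    rw [Equiv.Perm.card_support_conj]; exact (h1 i).2⟩, ?_⟩
  simp [List.ofFn_succ]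

lemma seven (σ : Equiv.Perm (Fin 7)) (hσ : Equiv.Perm.sign σ = 1) : IsProdOfCycles 7 3 3 σ := by
  have h2 := two_card_le σ
  have hs : σ.support.card ≤ 7 := by simpa using Finset.card_le_univ σ.support
  rcases Nat.lt_or_ge σ.support.card 7 with hlt | hge
  · exact main_if (by norm_num) (by norm_num) (by decide) σ hσ (by omega) (by omega)
  have h7 : σ.support.card = 7 := by omega
  have hpar : Even (7 + σ.cycleType.card) := by
    rw [Equiv.Perm.sign_of_cycleType, Equiv.Perm.sum_cycleType, h7] at hσ
    by_contra hh
    rw [Nat.not_even_iff_odd] at hh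
    rw [hh.neg_one_pow] at hσ
    exact absurd hσ (by decide)
  have hsum : σ.cycleType.sum = 7 := by rw [Equiv.Perm.sum_cycleType, h7]
  have hcard : σ.cycleType.card = 1 ∨ σ.cycleType.card = 3 := by
    have : σ.cycleType.card ≤ 3 := by omega
    generalize σ.cycleType.card = k at *
    interval_cases k <;> revert hpar <;> decide
  have aux : ∃ τ : Equiv.Perm (Fin 7), IsProdOfCycles 7 3 3 τ ∧ τ.cycleType = σ.cycleType := by
    rcases hcard with h | h
    · obtain ⟨a, ha⟩ := Multiset.card_eq_one.1 h
      rw [ha] at hsum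
      simp at hsum
      subst hsum
      refine ⟨[0,1,2].formPerm * [2,3,4].formPerm * [4,5,6].formPerm,
        three_of (by norm_num) ⟨[0,1,2], by decide, rfl, rfl⟩ ⟨[2,3,4], by decide, rfl, rfl⟩
          ⟨[4,5,6], by decide, rfl, rfl⟩ (by decide) (by decide) (by decide), ?_⟩
      have : ([0,1,2] : List (Fin 7)).formPerm * [2,3,4].formPerm * [4,5,6].formPerm =
        [0,1,2,3,4,5,6].formPerm := by simp [List.formPerm_cons_cons, mul_assoc]
      rw [this, ha, cycleType_list _ (by decide) (by decide)]
      rfl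
    · obtain ⟨a, b, c, habc⟩ := Multiset.card_eq_three.1 h
      have a2 : 2 ≤ a := Equiv.Perm.two_le_of_mem_cycleType (σ := σ) (by rw [habc]; simp)
      have b2 : 2 ≤ b := Equiv.Perm.two_le_of_mem_cycleType (σ := σ) (by rw [habc]; simp)
      have c2 : 2 ≤ c := Equiv.Perm.two_le_of_mem_cycleType (σ := σ) (by rw [habc]; simp)
      rw [habc] at hsum
      simp at hsum
      have hh : ({a, b, c} : Multiset ℕ) = {2, 2, 3} := by
        have : (a = 2 ∧ b = 2 ∧ c = 3) ∨ (a = 2 ∧ b = 3 ∧ c = 2) ∨ (a = 3 ∧ b = 2 ∧ c = 2) := by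
          omega
        rcases this with ⟨rfl, rfl, rfl⟩ | ⟨rfl, rfl, rfl⟩ | ⟨rfl, rfl, rfl⟩ <;> decide
      refine ⟨[4,5,6].formPerm * [0,1,2].formPerm * [1,2,3].formPerm,
        three_of (by norm_num) ⟨[4,5,6], by decide, rfl, rfl⟩ ⟨[0,1,2], by decide, rfl, rfl⟩
          ⟨[1,2,3], by decide, rfl, rfl⟩ (by decide) (by decide) (by decide), ?_⟩
      have : ([4,5,6] : List (Fin 7)).formPerm * [0,1,2].formPerm * [1,2,3].formPerm =
        [4,5,6].formPerm * ([0,1].formPerm * [2,3].formPerm) := by decide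
      rw [this, habc, hh]
      have d1 : Equiv.Perm.Disjoint ([0,1] : List (Fin 7)).formPerm [2,3].formPerm :=
        (List.formPerm_disjoint_iff (by decide) (by decide) (by decide) (by decide)).2
          (by intro x; fin_cases x <;> simp)
      have d2 : Equiv.Perm.Disjoint ([4,5,6] : List (Fin 7)).formPerm
          ([0,1].formPerm * [2,3].formPerm) := by
        apply Equiv.Perm.Disjoint.mul_right <;>
        exact (List.formPerm_disjoint_iff (by decide) (by decide) (by decide) (by decide)).2
          (by intro x; fin_cases x <;> simp)
      rw [d2.cycleType_mul, d1.cycleType_mul, cycleType_list _ (by decide) (by decide),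
        cycleType_list _ (by decide) (by decide),
        cycleType_list _ (by decide) (by decide)]
      decide
  obtain ⟨τ, hτ, hct⟩ := aux
  obtain ⟨π, hπ⟩ := isConj_iff.1 (Equiv.Perm.isConj_iff_cycleType_eq.2 hct)
  rw [← hπ]
  exact hτ.conj π

/-- precomposition with a permutation -/
def Tp {n : ℕ} (g : Equiv.Perm (Fin n)) : (Fin n → ℚ) →ₗ[ℚ] (Fin n → ℚ) := LinearMap.funLeft ℚ ℚ g

/-- `1 - T_g` -/
def Dp {n : ℕ} (g : Equiv.Perm (Fin n)) : (Fin n → ℚ) →ₗ[ℚ] (Fin n → ℚ) := LinearMap.id - Tp g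

lemma Dp_apply {n : ℕ} (g : Equiv.Perm (Fin n)) (f : Fin n → ℚ) (i : Fin n) :
    Dp g f i = f i - f (g i) := by
  simp [Dp, Tp, LinearMap.funLeft_apply]

/-- rank of `1 - T_g` -/
noncomputable def rk {n : ℕ} (g : Equiv.Perm (Fin n)) : ℕ := Module.finrank ℚ (LinearMap.range (Dp g))

lemma rk_mul {n : ℕ} (g h : Equiv.Perm (Fin n)) : rk (g * h) ≤ rk g + rk h := by
  -- D(gh) = D h + T_h D g
  have e : Dp (g * h) = Dp h ∘ₗ Tp g + Dp g := by
    ext f i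
    simp [Dp, Tp, LinearMap.funLeft_apply]
  have e1 : LinearMap.range (Dp (g * h)) ≤ LinearMap.range (Dp h) ⊔ LinearMap.range (Dp g) := by
    rintro _ ⟨f, rfl⟩
    rw [e]
    exact Submodule.add_mem_sup ⟨_, rfl⟩ ⟨_, rfl⟩
  have e2 := Submodule.finrank_mono e1
  have e3 := Submodule.finrank_add_le_finrank_add_finrank (LinearMap.range (Dp h))
    (LinearMap.range (Dp g))
  unfold rk
  omega

lemma rk_one {n : ℕ} : rk (1 : Equiv.Perm (Fin n)) = 0 := by
  have : Dp (1 : Equiv.Perm (Fin n)) = 0 := by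
    ext f i; simp [Dp_apply]
  rw [rk, this, LinearMap.range_zero]; simp

lemma rk_swap {n : ℕ} (x y : Fin n) : rk (Equiv.swap x y) ≤ 1 := by
  have : LinearMap.range (Dp (Equiv.swap x y)) ≤
      Submodule.span ℚ {(Pi.single x 1 - Pi.single y 1 : Fin n → ℚ)} := by
    rintro _ ⟨f, rfl⟩
    rw [Submodule.mem_span_singleton]
    refine ⟨f x - f y, ?_⟩
    ext i
    rw [Dp_apply]
    by_cases hx : i = x
    · subst hx
      by_cases hy : i = y
      · subst hy; simp
      · simp [hy]
    · by_cases hy : i = y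
      · subst hy; simp [hx]
      · simp [hx, hy, Equiv.swap_apply_of_ne_of_ne hx hy]
  exact (Submodule.finrank_mono this).trans
    ((finrank_span_le_card _).trans (by simp))

lemma rk_formPerm {n : ℕ} (L : List (Fin n)) : rk L.formPerm ≤ L.length - 1 := by
  induction L with
  | nil => simp [rk_one]
  | cons x L ih =>
    cases L with
    | nil => simp [rk_one]
    | cons y L =>
      rw [List.formPerm_cons_cons]
      have h1 := rk_mul (Equiv.swap x y) (y :: L).formPerm
      have h2 := rk_swap x y
      simp at ih ⊢
      omega

lemma rk_cycle {n : ℕ} {σ : Equiv.Perm (Fin n)} (h : σ.IsCycle) : rk σ + 1 ≤ σ.support.card := by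
  obtain ⟨L, h1, h2, h3⟩ := cycOn_of_isCycle h
  have := rk_formPerm L
  rw [h3] at this
  have h4 := h.two_le_card_support
  rw [← h2, List.toFinset_card_of_nodup h1] at h4 ⊢
  omega

lemma rk_le {n : ℕ} (σ : Equiv.Perm (Fin n)) : rk σ + σ.cycleType.card ≤ σ.support.card := by
  induction σ using Equiv.Perm.cycle_induction_on with
  | base_one => simp [rk_one]
  | base_cycles σ hσ => rw [hσ.cycleType]; simpa using rk_cycle hσ
  | induction_disjoint σ τ hd hσ ih1 ih2 =>
    rw [hd.cycleType_mul, hd.card_support_mul, Multiset.card_add]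
    have := rk_mul σ τ
    omega

/-- Scott's inequality -/
lemma scott {n : ℕ} (a b c : Equiv.Perm (Fin n)) :
    2 * n ≤ rk a + rk b + rk c + rk (a * b * c) +
      2 * Module.finrank ℚ (LinearMap.ker (Dp a) ⊓ LinearMap.ker (Dp b) ⊓ LinearMap.ker (Dp c) :
        Submodule ℚ (Fin n → ℚ)) := by
  set F := (LinearMap.ker (Dp a) ⊓ LinearMap.ker (Dp b) ⊓ LinearMap.ker (Dp c) :
        Submodule ℚ (Fin n → ℚ)) with hF
  set RA := LinearMap.range (Dp a)
  set RB := LinearMap.range (Dp b)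
  set RC := LinearMap.range (Dp c)
  have hV : Module.finrank ℚ (Fin n → ℚ) = n := by simp
  -- U
  set U := RA ⊔ RB ⊔ RC with hU
  have hUdim : n ≤ Module.finrank ℚ U + Module.finrank ℚ F := by
    have h1 := Subspace.finrank_add_finrank_dualAnnihilator_eq U
    rw [hV] at h1
    suffices Module.finrank ℚ U.dualAnnihilator ≤ Module.finrank ℚ F by omega
    let ev : Module.Dual ℚ (Fin n → ℚ) →ₗ[ℚ] (Fin n → ℚ) :=
      LinearMap.pi fun i => LinearMap.applyₗ (Pi.single i (1 : ℚ))
    have evap : ∀ φ i, ev φ i = φ (Pi.single i 1) := fun φ i => rfl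
    have hev : Function.Injective ev := by
      intro φ ψ h
      apply LinearMap.pi_ext'
      intro i
      apply LinearMap.ext_ring
      simpa [evap] using congrFun h i
    have key : ∀ (g : Equiv.Perm (Fin n)) (φ : Module.Dual ℚ (Fin n → ℚ)),
        (∀ w ∈ LinearMap.range (Dp g), φ w = 0) → ev φ ∈ LinearMap.ker (Dp g) := by
      intro g φ h
      rw [LinearMap.mem_ker]
      ext i
      rw [Dp_apply, evap, evap]
      have h2 := h _ ⟨Pi.single (g i) 1, rfl⟩
      have h3 : Dp g (Pi.single (g i) 1) = Pi.single (g i) 1 - Pi.single i 1 := by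
        ext j
        rw [Dp_apply]
        simp [Pi.single_apply]
      rw [h3, map_sub] at h2
      simp; linarith
    have hle : U.dualAnnihilator.map ev ≤ F := by
      rintro _ ⟨φ, hφ, rfl⟩
      rw [SetLike.mem_coe, Submodule.mem_dualAnnihilator] at hφ
      refine ⟨⟨key a φ fun w hw => hφ w ?_, key b φ fun w hw => hφ w ?_⟩, key c φ fun w hw => hφ w ?_⟩
      · exact Submodule.mem_sup_left (Submodule.mem_sup_left hw)
      · exact Submodule.mem_sup_left (Submodule.mem_sup_right hw)
      · exact Submodule.mem_sup_right hw
    have h2 := Submodule.finrank_mono hle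
    rwa [← (Submodule.equivMapOfInjective ev hev U.dualAnnihilator).finrank_eq] at h2
  -- the sum map
  let δ : (RA × RB × RC) →ₗ[ℚ] (Fin n → ℚ) :=
    RA.subtype.coprod (RB.subtype.coprod RC.subtype)
  have hδr : U ≤ LinearMap.range δ := by
    rw [hU]
    refine sup_le (sup_le ?_ ?_) ?_
    · intro w hw; exact ⟨(⟨w, hw⟩, 0, 0), by simp [δ]⟩
    · intro w hw; exact ⟨(0, ⟨w, hw⟩, 0), by simp [δ]⟩
    · intro w hw; exact ⟨(0, 0, ⟨w, hw⟩), by simp [δ]⟩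
  have hδ := LinearMap.finrank_range_add_finrank_ker δ
  have hprod : Module.finrank ℚ (RA × RB × RC) = rk a + rk b + rk c := by
    simp [rk, RA, RB, RC, add_assoc]
  -- β
  let β : (Fin n → ℚ) →ₗ[ℚ] (RA × RB × RC) :=
    (Dp a).rangeRestrict.prod (((Dp b).rangeRestrict ∘ₗ Tp a).prod
      ((Dp c).rangeRestrict ∘ₗ Tp b ∘ₗ Tp a))
  have hδβ : ∀ v, δ (β v) = Dp (a * b * c) v := by
    intro v
    ext i
    change Dp a v i + (Dp b (Tp a v) i + Dp c (Tp b (Tp a v)) i) = _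
    simp only [Dp_apply]
    simp [Tp, LinearMap.funLeft_apply]
  have hβk : LinearMap.ker β ≤ F := by
    intro v hv
    rw [LinearMap.mem_ker] at hv
    have h1 : Dp a v = 0 := congrArg (fun t => (t.1 : Fin n → ℚ)) hv
    have h2 : Dp b (Tp a v) = 0 := congrArg (fun t => (t.2.1 : Fin n → ℚ)) hv
    have h3 : Dp c (Tp b (Tp a v)) = 0 := congrArg (fun t => (t.2.2 : Fin n → ℚ)) hv
    have e1 : Tp a v = v := by
      have : v - Tp a v = 0 := h1
      exact (sub_eq_zero.1 this).symm
    rw [e1] at h2 h3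
    have e2 : Tp b v = v := by
      have : v - Tp b v = 0 := h2
      exact (sub_eq_zero.1 this).symm
    rw [e2] at h3
    exact ⟨⟨h1, h2⟩, h3⟩
  set K := LinearMap.ker (Dp (a * b * c)) with hK
  have hKd := LinearMap.finrank_range_add_finrank_ker (Dp (a * b * c))
  rw [hV, ← hK] at hKd
  have hb := LinearMap.finrank_range_add_finrank_ker (β ∘ₗ K.subtype)
  have hb1 : LinearMap.range (β ∘ₗ K.subtype) ≤ LinearMap.ker δ := by
    rintro _ ⟨v, rfl⟩
    rw [LinearMap.mem_ker]
    simp only [LinearMap.comp_apply, Submodule.subtype_apply]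
    rw [hδβ]; exact v.2
  have hb2 : Module.finrank ℚ (LinearMap.ker (β ∘ₗ K.subtype)) ≤ Module.finrank ℚ F := by
    have h1 : (LinearMap.ker (β ∘ₗ K.subtype)).map K.subtype ≤ F := by
      rintro _ ⟨v, hv, rfl⟩
      exact hβk hv
    have h2 := Submodule.finrank_mono h1
    rwa [← (Submodule.equivMapOfInjective K.subtype K.injective_subtype _).finrank_eq] at h2
  have q1 := Submodule.finrank_mono hb1
  have q2 := Submodule.finrank_mono hδr
  have q3 : rk (a * b * c) = Module.finrank ℚ (LinearMap.range (Dp (a * b * c))) := rfl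
  rw [hprod] at hδ
  omega

lemma const_on {n : ℕ} {a : Equiv.Perm (Fin n)} (ha : a.IsCycle) {f : Fin n → ℚ}
    (hf : f ∈ LinearMap.ker (Dp a)) {x y : Fin n} (hx : x ∈ a.support) (hy : y ∈ a.support) :
    f x = f y := by
  have h : ∀ i, f (a i) = f i := by
    intro i
    have := congrFun (LinearMap.mem_ker.1 hf) i
    rw [Dp_apply] at this
    simp at this; linarith
  have h2 : ∀ k : ℕ, f ((a ^ k) x) = f x := by
    intro k
    induction k with
    | zero => simp
    | succ k ih => rw [pow_succ', Equiv.Perm.mul_apply, h, ih]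
  obtain ⟨k, -, hk⟩ := (ha.sameCycle (Equiv.Perm.mem_support.1 hx)
    (Equiv.Perm.mem_support.1 hy)).exists_pow_eq'
  rw [← hk, h2]

lemma conn_bound {n l : ℕ} {a b c : Equiv.Perm (Fin n)} (ha : a.IsCycle) (hb : b.IsCycle)
    (hc : c.IsCycle) (hla : a.support.card = l) (hlb : b.support.card = l)
    (hlc : c.support.card = l)
    (h1 : ¬ (Disjoint a.support b.support ∧ Disjoint a.support c.support))
    (h2 : ¬ (Disjoint a.support b.support ∧ Disjoint b.support c.support))
    (h3 : ¬ (Disjoint a.support c.support ∧ Disjoint b.support c.support)) :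
    (a * b * c).support.card + (a * b * c).cycleType.card + 1 ≤ 3 * l := by
  have S := scott a b c
  have ra := rk_cycle ha
  have rb := rk_cycle hb
  have rc := rk_cycle hc
  have rs := rk_le (a * b * c)
  set F := (LinearMap.ker (Dp a) ⊓ LinearMap.ker (Dp b) ⊓ LinearMap.ker (Dp c) :
        Submodule ℚ (Fin n → ℚ)) with hF
  obtain ⟨p, hp⟩ : a.support.Nonempty := by
    rw [← Finset.card_pos]; have := ha.two_le_card_support; omega
  let ψ : (Fin n → ℚ) →ₗ[ℚ] (ℚ × ({x // x ∈ (a * b * c).supportᶜ} → ℚ)) :=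
    (LinearMap.proj p).prod (LinearMap.funLeft ℚ ℚ Subtype.val)
  have hinj : Function.Injective (ψ ∘ₗ F.subtype) := by
    rw [← LinearMap.ker_eq_bot, LinearMap.ker_eq_bot']
    rintro ⟨f, ⟨fa, fb⟩, fc⟩ hf
    have f1 : f p = 0 := congrArg Prod.fst hf
    have f2 : ∀ x, x ∉ (a * b * c).support → f x = 0 := fun x hx =>
      congrFun (congrArg Prod.snd hf) ⟨x, by simpa using hx⟩
    have zA : ∀ x ∈ a.support, f x = 0 := fun x hx => by rw [← f1]; exact const_on ha fa hx hp
    have prop : ∀ {g h : Equiv.Perm (Fin n)}, h.IsCycle → f ∈ LinearMap.ker (Dp h) →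
        ¬ Disjoint g.support h.support → (∀ x ∈ g.support, f x = 0) → ∀ x ∈ h.support, f x = 0 := by
      intro g h hh fh hd hg x hx
      obtain ⟨y, y1, y2⟩ := Finset.not_disjoint_iff.1 hd
      rw [← hg y y1]; exact const_on hh fh hx y2
    have zBC : (∀ x ∈ b.support, f x = 0) ∧ (∀ x ∈ c.support, f x = 0) := by
      by_cases hab : Disjoint a.support b.support
      · have hac : ¬ Disjoint a.support c.support := fun h => h1 ⟨hab, h⟩
        have hbc : ¬ Disjoint c.support b.support := fun h => h2 ⟨hab, h.symm⟩
        have zC := prop hc fc hac zA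
        exact ⟨prop hb fb hbc zC, zC⟩
      · have zB := prop hb fb hab zA
        refine ⟨zB, ?_⟩
        by_cases hac : Disjoint a.support c.support
        · exact prop hc fc (fun h => h3 ⟨hac, h⟩) zB
        · exact prop hc fc hac zA
    apply Subtype.ext
    ext x
    change f x = 0
    by_cases xa : x ∈ a.support
    · exact zA x xa
    by_cases xb : x ∈ b.support
    · exact zBC.1 x xb
    by_cases xc : x ∈ c.support
    · exact zBC.2 x xc
    apply f2
    rw [Equiv.Perm.notMem_support] at *
    simp [xa, xb, xc]
  have hd := LinearMap.finrank_le_finrank_of_injective hinj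
  have hcard : (a * b * c).supportᶜ.card = n - (a * b * c).support.card := by
    rw [Finset.card_compl, Fintype.card_fin]
  have hle : (a * b * c).support.card ≤ n := by simpa using Finset.card_le_univ (a * b * c).support
  rw [Module.finrank_prod, Module.finrank_self, Module.finrank_fintype_fun_eq_card,
    Fintype.card_coe, hcard] at hd
  omega

lemma three_bound {n l : ℕ} {σ : Equiv.Perm (Fin n)} (h : IsProdOfCycles n 3 l σ) :
    σ.support.card + σ.cycleType.card + 1 ≤ 3 * l ∨
      (l ∈ σ.cycleType ∧ σ.support.card ≤ 3 * l) := by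
  obtain ⟨t, ht, e⟩ := h
  obtain ⟨ha, hla⟩ := ht 0
  obtain ⟨hb, hlb⟩ := ht 1
  obtain ⟨hc, hlc⟩ := ht 2
  have e' : σ = t 0 * t 1 * t 2 := by rw [e]; simp [List.ofFn_succ, mul_assoc]
  generalize t 0 = a at *
  generalize t 1 = b at *
  generalize t 2 = c at *
  subst e'
  have hcard : (a * b * c).support.card ≤ 3 * l := by
    have h1 : (a * b * c).support ⊆ a.support ∪ b.support ∪ c.support := by
      intro x
      contrapose!
      simp only [Finset.mem_union, not_or, Equiv.Perm.notMem_support]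
      rintro ⟨⟨h1, h2⟩, h3⟩
      simp [h1, h2, h3]
    have h2 := Finset.card_le_card h1
    have h3 := Finset.card_union_le (a.support ∪ b.support) c.support
    have h4 := Finset.card_union_le a.support b.support
    omega
  have iso : ∀ x y : Equiv.Perm (Fin n), x.IsCycle → x.support.card = l → x.Disjoint y →
      l ∈ (x * y).cycleType := by
    intro x y hx hxl hd
    rw [hd.cycleType_mul, hx.cycleType, hxl]; simp
  by_cases h1 : Disjoint a.support b.support ∧ Disjoint a.support c.support
  · refine Or.inr ⟨?_, hcard⟩
    rw [mul_assoc]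
    exact iso a _ ha hla ((Equiv.Perm.disjoint_iff_disjoint_support.2 h1.1).mul_right
      (Equiv.Perm.disjoint_iff_disjoint_support.2 h1.2))
  by_cases h2 : Disjoint a.support b.support ∧ Disjoint b.support c.support
  · refine Or.inr ⟨?_, hcard⟩
    have d1 := Equiv.Perm.disjoint_iff_disjoint_support.2 h2.1
    have d2 := Equiv.Perm.disjoint_iff_disjoint_support.2 h2.2
    rw [d1.commute.eq, mul_assoc]
    exact iso b _ hb hlb (d1.symm.mul_right d2)
  by_cases h3 : Disjoint a.support c.support ∧ Disjoint b.support c.support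
  · refine Or.inr ⟨?_, hcard⟩
    have d1 := Equiv.Perm.disjoint_iff_disjoint_support.2 h3.1
    have d2 := Equiv.Perm.disjoint_iff_disjoint_support.2 h3.2
    have d3 : c.Disjoint (a * b) := d1.symm.mul_right d2.symm
    rw [← d3.commute.eq]
    exact iso c _ hc hlc d3
  exact Or.inl (conn_bound ha hb hc hla hlb hlc h1 h2 h3)

lemma use_type {n l : ℕ} (H : ∀ σ ∈ alternatingGroup (Fin n), IsProdOfCycles n 3 l σ)
    (m : Multiset ℕ) (h1 : m.sum ≤ n) (h2 : ∀ a ∈ m, 2 ≤ a) (h3 : Even (m.sum + m.card)) :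
    m.sum + m.card + 1 ≤ 3 * l ∨ (l ∈ m ∧ m.sum ≤ 3 * l) := by
  obtain ⟨σ, rfl⟩ := (Equiv.Perm.exists_with_cycleType_iff (Fin n)).2 ⟨by simpa using h1, h2⟩
  have := three_bound (H σ (by
    rw [Equiv.Perm.mem_alternatingGroup, Equiv.Perm.sign_of_cycleType, h3.neg_one_pow]))
  rwa [Equiv.Perm.sum_cycleType]

theorem product_of_three_l_cycles_iff (n l : ℕ) (hn : 2 ≤ n) (hl : 2 ≤ l) :
    (∀ σ ∈ alternatingGroup (Fin n), IsProdOfCycles n 3 l σ) ↔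
      (Odd l ∧ (((n + 1) / 2 ≤ l ∧ l ≤ n) ∨ (n = 7 ∧ l = 3))) := by
  constructor
  · intro H
    have hone := H 1 (one_mem _)
    obtain ⟨t, ht, e⟩ := hone
    have hln : l ≤ n := by
      rw [← (ht 0).2]; simpa using Finset.card_le_univ (t 0).support
    have hodd : Odd l := by
      by_contra hh
      rw [Nat.not_odd_iff_even] at hh
      have hs : ∀ i, Equiv.Perm.sign (t i) = -1 := fun i => by
        rw [(ht i).1.sign, (ht i).2, hh.neg_one_pow]
      have := congrArg Equiv.Perm.sign e
      simp [List.ofFn_succ, hs] at this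
    refine ⟨hodd, ?_⟩
    by_contra hcon
    obtain ⟨j, hj⟩ := hodd
    have hlt : l < (n + 1) / 2 := by
      by_contra h
      exact hcon (Or.inl ⟨by omega, hln⟩)
    have hne : ¬ (n = 7 ∧ l = 3) := fun h => hcon (Or.inr h)
    obtain ⟨k, hk⟩ : ∃ k, n = 4 * k ∨ n = 4 * k + 1 ∨ n = 4 * k + 2 ∨ n = 4 * k + 3 :=
      ⟨n / 4, by omega⟩
    rcases hk with hk | hk | hk | hk
    · have := use_type H (Multiset.replicate (2 * k) 2) (by simp; omega)
        (fun a ha => by rw [Multiset.eq_of_mem_replicate ha])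
        (by simp; exact ⟨3 * k, by ring⟩)
      simp [Multiset.mem_replicate] at this
      omega
    · have := use_type H (Multiset.replicate (2 * k) 2) (by simp; omega)
        (fun a ha => by rw [Multiset.eq_of_mem_replicate ha])
        (by simp; exact ⟨3 * k, by ring⟩)
      simp [Multiset.mem_replicate] at this
      omega
    · have hk1 : 1 ≤ k := by omega
      have := use_type H (4 ::ₘ Multiset.replicate (2 * k - 1) 2) (by simp; omega)
        (fun a ha => by
          rcases Multiset.mem_cons.1 ha with rfl | ha
          · norm_num
          · rw [Multiset.eq_of_mem_replicate ha])
        (by simp only [Multiset.sum_cons, Multiset.card_cons, Multiset.sum_replicate,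
              Multiset.card_replicate, smul_eq_mul]; exact ⟨3 * k + 1, by omega⟩)
      simp [Multiset.mem_replicate] at this
      omega
    · have := use_type H (3 ::ₘ Multiset.replicate (2 * k) 2) (by simp; omega)
        (fun a ha => by
          rcases Multiset.mem_cons.1 ha with rfl | ha
          · norm_num
          · rw [Multiset.eq_of_mem_replicate ha])
        (by simp only [Multiset.sum_cons, Multiset.card_cons, Multiset.sum_replicate,
              Multiset.card_replicate, smul_eq_mul]; exact ⟨3 * k + 2, by omega⟩)
      simp [Multiset.mem_replicate] at this
      omega
  · rintro ⟨hodd, ⟨h1, h2⟩ | ⟨rfl, rfl⟩⟩ σ hσ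
    · rw [Equiv.Perm.mem_alternatingGroup] at hσ
      have h3 := two_card_le σ
      have h4 : σ.support.card ≤ n := by simpa using Finset.card_le_univ σ.support
      exact main_if hl h2 hodd σ hσ (by omega) (by omega)
    · exact seven σ (Equiv.Perm.mem_alternatingGroup.1 hσ)
end

section
/- For natural numbers n, l ≥ 2, every element σ ∈ A_n is a product of four l-cycles of S_n if and only if one of the following holds: (1) n ≢ 1 (mod 8) and ⌈3n/8⌉ ≤ l ≤ n; (2) n ≡ 1 (mod 8) and ⌊3n/8⌋ ≤ l ≤ n; (3) n = 6 and l = 2. -/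
open Equiv

set_option linter.unusedSectionVars false
set_option linter.unnecessarySimpa false

section cyc
variable {α : Type*} [DecidableEq α] [Fintype α]

def Cyc (f : Perm α) (S : Finset α) : Prop :=
  ∃ L : List α, L ≠ [] ∧ L.Nodup ∧ L.toFinset = S ∧ L.formPerm = f

lemma formPerm_split (u : List α) (x : α) (v : List α) :
    (u ++ x :: v).formPerm = (u ++ [x]).formPerm * (x :: v).formPerm := by
  induction u with
  | nil => simp
  | cons a u ih =>
    cases u with
    | nil => simp
    | cons b u =>
      simp only [List.cons_append, List.formPerm_cons_cons] at ih ⊢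
      rw [ih, mul_assoc]

lemma Cyc.fix {f : Perm α} {S : Finset α} (h : Cyc f S) {x : α} (hx : x ∉ S) : f x = x := by
  obtain ⟨L, h0, h1, rfl, rfl⟩ := h
  exact List.formPerm_apply_of_notMem (by simpa using hx)

lemma Cyc.mem {f : Perm α} {S : Finset α} (h : Cyc f S) {x : α} : f x ∈ S ↔ x ∈ S := by
  obtain ⟨L, h0, h1, rfl, rfl⟩ := h
  simpa using List.formPerm_apply_mem_iff_mem

lemma Cyc.mem_inv {f : Perm α} {S : Finset α} (h : Cyc f S) {x : α} : f⁻¹ x ∈ S ↔ x ∈ S := by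
  rw [← h.mem]; simp

lemma cyc_one (x : α) : Cyc (1 : Perm α) {x} := ⟨[x], by simp⟩

lemma Cyc.nonempty {f : Perm α} {S : Finset α} (h : Cyc f S) : S.Nonempty := by
  obtain ⟨L, h0, h1, rfl, rfl⟩ := h
  simpa [List.toFinset_nonempty_iff] using h0

lemma Cyc.isCycle {f : Perm α} {S : Finset α} (h : Cyc f S) (h2 : 2 ≤ S.card) :
    f.IsCycle ∧ f.support = S := by
  obtain ⟨L, h0, h1, rfl, rfl⟩ := h
  rw [List.toFinset_card_of_nodup h1] at h2
  refine ⟨List.isCycle_formPerm h1 h2, List.support_formPerm_of_nodup _ h1 ?_⟩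
  rintro x rfl
  simp at h2

lemma cyc_of_isCycle {f : Perm α} (h : f.IsCycle) : Cyc f f.support := by
  obtain ⟨x, hx, hc⟩ := h
  have hx' : x ∈ f.support := by simpa using hx
  have hcyc : f.IsCycle := ⟨x, hx, hc⟩
  refine ⟨f.toList x, ?_, f.nodup_toList x, ?_, ?_⟩
  · rw [Ne, Perm.toList_eq_nil_iff]; simpa using hx
  · ext y
    simp only [List.mem_toFinset, Perm.mem_toList_iff]
    constructor
    · rintro ⟨h1, h2⟩; exact (h1.mem_support_iff).1 h2
    · intro hy; exact ⟨hc (by simpa using hy), hx'⟩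
  · rw [Perm.formPerm_toList, hcyc.cycleOf_eq hx]

lemma Cyc.merge {f g : Perm α} {S T : Finset α} (hf : Cyc f S) (hg : Cyc g T)
    (hd : Disjoint S T) {x p : α} (hx : x ∈ S) (hp : p ∈ T) :
    Cyc (f * swap x p * g) (S ∪ T) := by
  obtain ⟨L, h0, h1, rfl, rfl⟩ := hf
  obtain ⟨M, k0, k1, rfl, rfl⟩ := hg
  simp only [List.mem_toFinset] at hx hp
  obtain ⟨u, v, rfl⟩ := List.append_of_mem hx
  obtain ⟨s, t, rfl⟩ := List.append_of_mem hp
  have e1 : (u ++ x :: v).formPerm = ((v ++ u) ++ [x]).formPerm := by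
    apply List.formPerm_eq_of_isRotated h1
    have : v ++ u ++ [x] = v ++ (u ++ [x]) := by simp
    rw [this]
    have h2 : u ++ x :: v = (u ++ [x]) ++ v := by simp
    rw [h2]
    exact List.isRotated_append
  have e2 : (s ++ p :: t).formPerm = (p :: (t ++ s)).formPerm := by
    apply List.formPerm_eq_of_isRotated k1
    have : p :: (t ++ s) = (p :: t) ++ s := by simp
    rw [this]
    exact List.isRotated_append
  refine ⟨(v ++ u) ++ x :: p :: (t ++ s), by simp, ?_, ?_, ?_⟩
  · rw [List.disjoint_toFinset_iff_disjoint] at hd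
    have hp1 : ((v ++ u) ++ x :: p :: (t ++ s)).Perm ((u ++ x :: v) ++ (s ++ p :: t)) := by
      rw [List.perm_iff_count]; intro a
      simp only [List.count_append, List.count_cons]; omega
    exact hp1.nodup_iff.2 (h1.append k1 hd)
  · ext a; simp; tauto
  · rw [formPerm_split, List.formPerm_cons_cons, e1, e2, mul_assoc]

lemma Cyc.merge_left {f g : Perm α} {S T : Finset α} (hf : Cyc f S) (hg : Cyc g T)
    (hd : Disjoint S T) {x p : α} (hx : x ∈ S) (hp : p ∈ T) :
    Cyc (swap x p * f * g) (S ∪ T) := by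
  have h := hf.merge hg hd (hf.mem_inv.2 hx) hp
  have hfp : f⁻¹ p = p := by
    rw [Perm.inv_eq_iff_eq, hf.fix (Finset.disjoint_right.1 hd hp)]
  have : swap x p * f = f * swap (f⁻¹ x) p := by
    conv_rhs => rw [← hfp]
    rw [Equiv.mul_swap_eq_swap_mul]; simp
  rw [this]; exact h

lemma Cyc.merge_right {f g : Perm α} {S T : Finset α} (hf : Cyc f S) (hg : Cyc g T)
    (hd : Disjoint S T) {x p : α} (hx : x ∈ S) (hp : p ∈ T) :
    Cyc (f * g * swap x p) (S ∪ T) := by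
  have h := hf.merge hg hd hx (hg.mem.2 hp)
  have hfp : g x = x := hg.fix (Finset.disjoint_left.1 hd hx)
  have : g * swap x p = swap x (g p) * g := by
    rw [Equiv.mul_swap_eq_swap_mul, hfp]
  rw [mul_assoc, this, ← mul_assoc]; exact h

lemma Cyc.split {f : Perm α} {S : Finset α} (hf : Cyc f S) {a b : ℕ} (ha : 1 ≤ a) (hb : 1 ≤ b)
    (hab : a + b = S.card + 1) :
    ∃ f1 f2 S1 S2 x, Cyc f1 S1 ∧ Cyc f2 S2 ∧ x ∈ S1 ∧ x ∈ S2 ∧ S1 ⊆ S ∧ S2 ⊆ S ∧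
      S1.card = a ∧ S2.card = b ∧ f = f1 * f2 := by
  obtain ⟨L, h0, h1, rfl, rfl⟩ := hf
  rw [List.toFinset_card_of_nodup h1] at hab
  have hlt : a - 1 < L.length := by omega
  have hL : L = L.take (a-1) ++ L[a-1] :: L.drop (a-1+1) := by simp
  generalize hu : L.take (a-1) = u at hL
  generalize L[a-1] = x at hL
  generalize L.drop (a-1+1) = v at hL
  have hul : u.length = a - 1 := by rw [← hu]; simp; omega
  subst hL
  have n1 : (u ++ [x]).Nodup := by
    apply List.Nodup.sublist _ h1
    simp
  have n2 : (x :: v).Nodup := by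
    apply List.Nodup.sublist _ h1
    simp
  refine ⟨(u ++ [x]).formPerm, (x :: v).formPerm, (u ++ [x]).toFinset, (x::v).toFinset, x,
    ⟨_, by simp, n1, rfl, rfl⟩, ⟨_, by simp, n2, rfl, rfl⟩, by simp, by simp, ?_, ?_, ?_, ?_, ?_⟩
  · intro y; simp; tauto
  · intro y; simp; tauto
  · rw [List.toFinset_card_of_nodup n1]; simp; omega
  · rw [List.toFinset_card_of_nodup n2]; simp at hab ⊢; omega
  · exact formPerm_split _ _ _

lemma commute_of_fix {f g : Perm α} {S T : Finset α} (hf : ∀ x, x ∉ S → f x = x)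
    (hg : ∀ x, x ∉ T → g x = x) (hd : Disjoint S T) : f * g = g * f := by
  apply Perm.Disjoint.commute
  intro x
  by_cases h : x ∈ S
  · exact Or.inr (hg x (Finset.disjoint_left.1 hd h))
  · exact Or.inl (hf x h)

/-- attach a new cycle to a pair of overlapping cycles. -/
lemma attach {c1 c2 r : Perm α} {S1 S2 T : Finset α} (h1 : Cyc c1 S1) (h2 : Cyc c2 S2)
    (hr : Cyc r T) {x : α} (hx1 : x ∈ S1) (hx2 : x ∈ S2) (hd1 : Disjoint T S1)
    (hd2 : Disjoint T S2) {a b : ℕ} (ha : 1 ≤ a) (hb : 1 ≤ b) (hab : a + b = T.card + 1) :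
    ∃ d1 d2 U1 U2, Cyc d1 U1 ∧ Cyc d2 U2 ∧ U1 ⊆ T ∪ S1 ∧ U2 ⊆ T ∪ S2 ∧ x ∈ U1 ∧ x ∈ U2 ∧
      U1.card = a + S1.card ∧ U2.card = b + S2.card ∧ r * (c1 * c2) = d1 * d2 := by
  obtain ⟨r1, r2, T1, T2, p, k1, k2, hp1, hp2, s1, s2, rfl, rfl, rfl⟩ := hr.split ha hb hab
  have q1 : Disjoint T1 S1 := Finset.disjoint_of_subset_left s1 hd1
  have q2 : Disjoint T2 S2 := Finset.disjoint_of_subset_left s2 hd2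
  have q3 : Disjoint T2 S1 := Finset.disjoint_of_subset_left s2 hd1
  refine ⟨_, _, _, _, k1.merge_right h1 q1 hp1 hx1, k2.merge_left h2 q2 hp2 hx2, ?_, ?_, ?_, ?_,
    ?_, ?_, ?_⟩
  · exact Finset.union_subset_union_left s1
  · exact Finset.union_subset_union_left s2
  · simp [hx1]
  · simp [hx2]
  · exact Finset.card_union_of_disjoint q1
  · exact Finset.card_union_of_disjoint q2
  · have hc := commute_of_fix (fun x => k2.fix) (fun x => h1.fix) q3
    calc r1 * r2 * (c1 * c2) = r1 * (r2 * c1) * c2 := by group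
      _ = r1 * c1 * r2 * c2 := by rw [hc]; group
      _ = r1 * c1 * (swap p x * swap p x) * r2 * c2 := by rw [swap_mul_self]; group
      _ = _ := by group

def Prod2 (σ : Perm α) (l : ℕ) : Prop :=
  ∃ c1 c2 S1 S2, Cyc c1 S1 ∧ Cyc c2 S2 ∧ S1.card = l ∧ S2.card = l ∧ σ = c1 * c2

lemma Prod2.succ {σ : Perm α} {l : ℕ} (h : Prod2 σ l) (hl : l < Fintype.card α) :
    Prod2 σ (l+1) := by
  obtain ⟨c1, c2, S1, S2, h1, h2, e1, e2, rfl⟩ := h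
  suffices H : ∃ x p, x ∈ S1 ∧ p ∉ S1 ∧ ((x ∈ S2 ∧ p ∉ S2) ∨ (p ∈ S2 ∧ x ∉ S2)) by
    obtain ⟨x, p, hx, hp, h⟩ := H
    have hd : Disjoint S1 {p} := by simpa using hp
    have key : c1 * c2 = (c1 * 1 * swap x p) * (swap x p * c2 * 1) := by
      rw [mul_one, mul_one, mul_assoc, ← mul_assoc (swap x p), swap_mul_self, one_mul]
    rcases h with ⟨hx2, hp2⟩ | ⟨hp2, hx2⟩
    · have hd2 : Disjoint S2 {p} := by simpa using hp2
      refine ⟨_, _, _, _, h1.merge_right (cyc_one p) hd hx (by simp),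
        h2.merge_left (cyc_one p) hd2 hx2 (by simp), ?_, ?_, key⟩
      · rw [Finset.card_union_of_disjoint hd]; simp [e1]
      · rw [Finset.card_union_of_disjoint hd2]; simp [e2]
    · have hd2 : Disjoint S2 {x} := by simpa using hx2
      refine ⟨_, _, _, _, h1.merge_right (cyc_one p) hd hx (Finset.mem_singleton_self p),
        h2.merge_left (cyc_one x) hd2 hp2 (Finset.mem_singleton_self x), ?_, ?_, by rw [key, swap_comm p x]⟩
      · rw [Finset.card_union_of_disjoint hd]; simp [e1]
      · rw [Finset.card_union_of_disjoint hd2]; simp [e2]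
  by_cases hS : S1 = S2
  · subst hS
    obtain ⟨x, hx⟩ := h1.nonempty
    obtain ⟨p, hp⟩ : ∃ p, p ∉ S1 := by
      by_contra! hcon
      have : S1 = Finset.univ := by ext; simp [hcon]
      rw [this, Finset.card_univ] at e1; omega
    exact ⟨x, p, hx, hp, Or.inl ⟨hx, hp⟩⟩
  · obtain ⟨x, hx, hx'⟩ := Finset.not_subset.1 (fun h => hS (Finset.eq_of_subset_of_card_le h (by omega)))
    obtain ⟨p, hp, hp'⟩ := Finset.not_subset.1
      (fun h => hS (Finset.eq_of_subset_of_card_le (s := S2) (t := S1) h (by omega)).symm)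
    exact ⟨x, p, hx, hp', Or.inr ⟨hp, hx'⟩⟩

lemma Prod2.mono {σ : Perm α} {l m : ℕ} (h : Prod2 σ l) (hlm : l ≤ m) (hm : m ≤ Fintype.card α) :
    Prod2 σ m := by
  induction m, hlm using Nat.le_induction with
  | base => exact h
  | succ k hk ih => exact (ih (by omega)).succ (by omega)

inductive Dec : Perm α → Finset α → List ℕ → Prop
  | nil (S : Finset α) : Dec 1 S []
  | cons {f σ : Perm α} {T S U : Finset α} {a : ℕ} {L : List ℕ} (hf : Cyc f T) (ha : T.card = a)
    (h2 : 2 ≤ a)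
    (hs : Dec σ S L) (hd : Disjoint T S) (hTU : T ⊆ U) (hSU : S ⊆ U) : Dec (f * σ) U (a :: L)

def wt (L : List ℕ) : ℕ := (L.map (· + 1)).sum

@[simp] lemma wt_nil : wt [] = 0 := rfl
@[simp] lemma wt_cons (a : ℕ) (L : List ℕ) : wt (a :: L) = a + 1 + wt L := by simp [wt]
@[simp] lemma wt_append (L M : List ℕ) : wt (L ++ M) = wt L + wt M := by simp [wt]

lemma Dec.superset {σ : Perm α} {S U : Finset α} {L : List ℕ} (h : Dec σ S L) (hSU : S ⊆ U) :
    Dec σ U L := by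
  cases h with
  | nil => exact Dec.nil U
  | cons hf ha h2 hs hd h3 h4 => exact Dec.cons hf ha h2 hs hd (h3.trans hSU) (h4.trans hSU)

lemma Dec.fix {σ : Perm α} {S : Finset α} {L : List ℕ} (h : Dec σ S L) :
    ∀ x, x ∉ S → σ x = x := by
  induction h with
  | nil => simp
  | cons hf ha h2 hs hd h3 h4 ih =>
    intro x hx
    rw [Perm.mul_apply, ih x (fun h => hx (h4 h)), hf.fix (fun h => hx (h3 h))]

lemma Dec.sign {σ : Perm α} {S : Finset α} {L : List ℕ} (h : Dec σ S L) :
    Perm.sign σ = (-1) ^ wt L := by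
  induction h with
  | nil => simp
  | cons hf ha h2 hs hd h3 h4 ih =>
    subst ha
    obtain ⟨hc, hs⟩ := hf.isCycle h2
    rw [map_mul, ih, hc.sign, hs, wt_cons]
    simp [pow_add]

lemma Dec.even {σ : Perm α} {S : Finset α} {L : List ℕ} (h : Dec σ S L) (hs : Perm.sign σ = 1) :
    Even (wt L) := by
  rw [h.sign] at hs
  by_contra hc
  rw [Nat.not_even_iff_odd] at hc
  rw [hc.neg_one_pow] at hs
  exact absurd hs (by decide)

lemma Dec.of_append {L1 : List ℕ} : ∀ {σ : Perm α} {S : Finset α} {L2 : List ℕ}, Dec σ S (L1 ++ L2) →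
    ∃ a b S1 S2, Dec a S1 L1 ∧ Dec b S2 L2 ∧ Disjoint S1 S2 ∧ S1 ⊆ S ∧ S2 ⊆ S ∧ σ = a * b := by
  induction L1 with
  | nil =>
    intro σ S L2 h
    exact ⟨1, σ, ∅, S, Dec.nil _, h, by simp, by simp, by simp, by simp⟩
  | cons c L1 ih =>
    intro σ S L2 h
    rw [List.cons_append] at h
    cases h with
    | cons hf ha h2 hs hd h3 h4 =>
      obtain ⟨a, b, S1, S2, k1, k2, k3, k4, k5, rfl⟩ := ih hs
      refine ⟨_, b, _, S2, Dec.cons hf ha h2 k1 (Finset.disjoint_of_subset_right k4 hd)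
        Finset.subset_union_left Finset.subset_union_right, k2, ?_, ?_, k5.trans h4, by group⟩
      · rw [Finset.disjoint_union_left]
        exact ⟨Finset.disjoint_of_subset_right k5 hd, k3⟩
      · exact Finset.union_subset h3 (k4.trans h4)

lemma Dec.append {a b : Perm α} {S1 S2 : Finset α} {L1 L2 : List ℕ} (h1 : Dec a S1 L1)
    (h2 : Dec b S2 L2) (hd : Disjoint S1 S2) : Dec (a * b) (S1 ∪ S2) (L1 ++ L2) := by
  induction h1 with
  | nil => simpa using h2.superset Finset.subset_union_right
  | cons hf ha h2' hs hd' h3 h4 ih =>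
    rw [mul_assoc]
    refine Dec.cons hf ha h2' (ih (Finset.disjoint_of_subset_left h4 hd)) ?_ ?_ ?_
    · rw [Finset.disjoint_union_right]
      exact ⟨hd', Finset.disjoint_of_subset_left h3 hd⟩
    · exact h3.trans Finset.subset_union_left
    · exact Finset.union_subset_union_left h4

lemma Dec.perm {σ : Perm α} {S : Finset α} {L M : List ℕ} (h : Dec σ S L) (hp : L.Perm M) :
    Dec σ S M := by
  induction hp generalizing σ S with
  | nil => exact h
  | cons x _ ih =>
    cases h with
    | cons hf ha h2 hs hd h3 h4 => exact Dec.cons hf ha h2 (ih hs) hd h3 h4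
  | swap x y l =>
    cases h with
    | @cons f _ T _ _ _ _ hf ha h2 hs hd h3 h4 =>
      cases hs with
      | @cons g τ T' S' _ _ _ hf' ha' h2' hs' hd' h3' h4' =>
        have hTT := Finset.disjoint_of_subset_right h3' hd
        have : f * (g * τ) = g * (f * τ) := by
          rw [← mul_assoc, commute_of_fix (fun x => hf.fix) (fun x => hf'.fix) hTT, mul_assoc]
        rw [this]
        refine Dec.cons (S := T ∪ S') hf' ha' h2' (Dec.cons hf ha h2 hs'
          (Finset.disjoint_of_subset_right h4' hd) Finset.subset_union_left Finset.subset_union_right) ?_ (h3'.trans h4) ?_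
        · rw [Finset.disjoint_union_right]; exact ⟨hTT.symm, hd'⟩
        · exact Finset.union_subset h3 (h4'.trans h4)
  | trans _ _ ih1 ih2 => exact ih2 (ih1 h)

lemma Dec.two_le {σ : Perm α} {S : Finset α} {L : List ℕ} (h : Dec σ S L) : ∀ a ∈ L, 2 ≤ a := by
  induction h with
  | nil => simp
  | cons hf ha h2 hs hd h3 h4 ih => 
    simpa using ⟨h2, ih⟩

lemma Dec.sum_le {σ : Perm α} {S : Finset α} {L : List ℕ} (h : Dec σ S L) : L.sum ≤ S.card := by
  induction h with
  | nil => simp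
  | cons hf ha h2 hs hd h3 h4 ih => 
    have := Finset.card_le_card (Finset.union_subset h3 h4)
    rw [Finset.card_union_of_disjoint hd] at this
    simp; omega

lemma exists_dec (σ : Perm α) : ∃ L, Dec σ σ.support L := by
  induction σ using Perm.cycle_induction_on with
  | base_one => exact ⟨[], Dec.nil _⟩
  | base_cycles f hf =>
    refine ⟨[f.support.card], ?_⟩
    have := Dec.cons (cyc_of_isCycle hf) rfl hf.two_le_card_support (Dec.nil ∅) (by simp)
      (Finset.Subset.refl _) (by simp)
    simpa using this
  | induction_disjoint f g hd hc h1 h2 =>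
    obtain ⟨L1, h1⟩ := h1
    obtain ⟨L2, h2⟩ := h2
    rw [hd.support_mul]
    exact ⟨_, h1.append h2 hd.disjoint_support⟩

lemma dec_two {σ : Perm α} {S : Finset α} {L : List ℕ} (h : Dec σ S L) (hL : L ≠ []) :
    ∃ c1 c2 S1 S2 x, Cyc c1 S1 ∧ Cyc c2 S2 ∧ S1 ⊆ S ∧ S2 ⊆ S ∧ x ∈ S1 ∧ x ∈ S2 ∧
      S1.card = wt L / 2 ∧ S2.card = (wt L + 1) / 2 ∧ σ = c1 * c2 := by
  induction h with
  | nil => simp at hL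
  | @cons f σ T S U a L hf ha h2 hs hd h3 h4 ih =>
    by_cases hL' : L = []
    · subst hL'
      cases hs
      obtain ⟨f1, f2, S1, S2, x, k1, k2, k3, k4, k5, k6, k7, k8, rfl⟩ :=
        hf.split (a := (a+1)/2) (b := (a+2)/2) (by omega) (by omega) (by omega)
      exact ⟨f1, f2, S1, S2, x, k1, k2, k5.trans h3, k6.trans h3, k3, k4, by simpa using k7,
        by rw [k8, wt_cons, wt_nil], by simp⟩
    · obtain ⟨c1, c2, S1, S2, x, k1, k2, k3, k4, k5, k6, k7, k8, rfl⟩ := ih hL'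
      obtain ⟨d1, d2, U1, U2, g1, g2, g3, g4, g5, g6, g7, g8, e⟩ :=
        attach k1 k2 hf k5 k6 (Finset.disjoint_of_subset_right k3 hd)
        (Finset.disjoint_of_subset_right k4 hd)
        (a := (a + 1 + wt L)/2 - wt L/2) (b := (a+1+wt L + 1)/2 - (wt L + 1)/2)
        (by omega) (by omega) (by omega)
      refine ⟨d1, d2, U1, U2, x, g1, g2, ?_, ?_, g5, g6, ?_, ?_, e⟩
      · exact g3.trans (Finset.union_subset h3 (k3.trans h4))
      · exact g4.trans (Finset.union_subset h3 (k4.trans h4))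
      · rw [g7, k7, wt_cons]; omega
      · rw [g8, k8, wt_cons]; omega

lemma dec_prod2 {σ : Perm α} {S : Finset α} {L : List ℕ} (h : Dec σ S L) (he : Even (wt L))
    {l : ℕ} (hw : wt L ≤ 2 * l) (h1 : 1 ≤ l) (hl : l ≤ Fintype.card α) : Prod2 σ l := by
  by_cases hL : L = []
  · subst hL
    cases h
    have : 0 < Fintype.card α := by omega
    obtain ⟨x⟩ := Fintype.card_pos_iff.1 this
    exact Prod2.mono (l := 1) ⟨1, 1, {x}, {x}, cyc_one x, cyc_one x, by simp⟩ h1 hl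
  · obtain ⟨c1, c2, S1, S2, x, k1, k2, k3, k4, k5, k6, k7, k8, rfl⟩ := dec_two h hL
    obtain ⟨r, hr⟩ := he
    exact Prod2.mono (l := r) ⟨c1, c2, S1, S2, k1, k2, by omega, by omega, rfl⟩ (by omega) hl

def Prod4 (σ : Perm α) (l : ℕ) : Prop := ∃ a b, Prod2 a l ∧ Prod2 b l ∧ σ = a * b

lemma Prod4.mono {σ : Perm α} {l m : ℕ} (h : Prod4 σ l) (hlm : l ≤ m) (hm : m ≤ Fintype.card α) :
    Prod4 σ m := by
  obtain ⟨a, b, h1, h2, h3⟩ := h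
  exact ⟨a, b, h1.mono hlm hm, h2.mono hlm hm, h3⟩

lemma Cyc.dec {f : Perm α} {S : Finset α} {a : ℕ} (hf : Cyc f S) (ha : S.card = a) (h2 : 2 ≤ a) :
    Dec f S [a] := by
  have := Dec.cons hf ha h2 (Dec.nil ∅) (by simp) (Finset.Subset.refl _) (by simp)
  simpa using this

/-- greedy splitting -/
lemma split_dec {σ : Perm α} {S : Finset α} {L : List ℕ} (h : Dec σ S L) :
    ∀ t, t ≠ 1 → t ≤ wt L → ∃ a b S1 S2 L1 L2, Dec a S1 L1 ∧ Dec b S2 L2 ∧ S1 ⊆ S ∧ S2 ⊆ S ∧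
      σ = a * b ∧ wt L1 ≤ t ∧ Even (wt L1 + t) ∧ wt L2 + t ≤ wt L + 2 := by
  induction h with
  | nil S =>
    intro t h1 h2
    refine ⟨1, 1, ∅, ∅, [], [], Dec.nil _, Dec.nil _, by simp, by simp, by simp, ?_⟩
    simp at h2; subst h2; simp
  | @cons f σ T S U a L hf ha h2 hs hd h3 h4 ih =>
    intro t ht1 ht
    rw [wt_cons] at ht
    by_cases h02 : t = 0 ∨ t = 2
    · refine ⟨1, _, ∅, U, [], _, Dec.nil _, Dec.cons hf ha h2 hs hd h3 h4, by simp, by simp,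
        by simp, by simp, ?_, ?_⟩
      · rcases h02 with rfl | rfl <;> simp
      · omega
    by_cases hta : t < a + 1
    · obtain ⟨f1, f2, T1, T2, x, k1, k2, k3, k4, k5, k6, k7, k8, rfl⟩ :=
        hf.split (a := t - 1) (b := a + 2 - t) (by omega) (by omega) (by omega)
      refine ⟨_, _, _, _, _, _, k1.dec k7 (by omega), Dec.cons k2 k8 (by omega) hs
        (Finset.disjoint_of_subset_left k6 hd) (k6.trans h3) h4, k5.trans h3,
        Finset.Subset.refl _, by group, ?_, ?_, ?_⟩
      · simp; omega
      · rw [Nat.even_iff]; simp; omega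
      · simp; omega
    by_cases hta1 : t - (a + 1) = 1
    · cases hs with
      | nil => simp at ht; omega
      | @cons g σ T' S' _ a' L hf' ha' h2' hs' hd' h3' h4' =>
        obtain ⟨f1, f2, T1, T2, x, k1, k2, k3, k4, k5, k6, k7, k8, rfl⟩ :=
          hf'.split (a := 1) (b := a') (by omega) (by omega) (by omega)
        obtain ⟨d1, d2, U1, U2, g1, g2, g3, g4, g5, g6, g7, g8, e⟩ := attach k1 k2 hf k3 k4
          (Finset.disjoint_of_subset_right (k5.trans h3') hd)
          (Finset.disjoint_of_subset_right (k6.trans h3') hd) (a := a) (b := 1) (by omega)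
          (by omega) (by omega)
        have hdd : Disjoint U2 S' := by
          apply Finset.disjoint_of_subset_left g4
          rw [Finset.disjoint_union_left]
          exact ⟨Finset.disjoint_of_subset_right h4' hd, Finset.disjoint_of_subset_left k6 hd'⟩
        have hU1 : U1 ⊆ U := g3.trans (Finset.union_subset h3 ((k5.trans h3').trans h4))
        have hU2 : U2 ⊆ U := g4.trans (Finset.union_subset h3 ((k6.trans h3').trans h4))
        refine ⟨_, _, _, _, _, _, g1.dec g7 (by omega), Dec.cons g2 g8 (by omega) hs' hdd
          hU2 (h4'.trans h4), hU1, Finset.Subset.refl _, ?_, ?_, ?_, ?_⟩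
        · rw [← mul_assoc d1, ← e]; group
        · simp; omega
        · rw [Nat.even_iff]; simp; omega
        · simp; omega
    · obtain ⟨α', β', S1, S2, L1, L2, k1, k2, k3, k4, k5, k6, k7, k8⟩ :=
        ih (t - (a+1)) hta1 (by omega)
      refine ⟨_, _, U, _, _, _, Dec.cons hf ha h2 k1 (Finset.disjoint_of_subset_right k3 hd) h3
        (k3.trans h4), k2, Finset.Subset.refl _, k4.trans h4, ?_, ?_, ?_, ?_⟩
      · rw [k5]; group
      · simp; omega
      · rw [Nat.even_iff] at k7 ⊢; simp; omega
      · simp; omega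

lemma dec_split_at {σ : Perm α} {S : Finset α} {L L1 L2 : List ℕ} (h : Dec σ S L)
    (hp : L.Perm (L1 ++ L2)) {l : ℕ} (h1 : 1 ≤ l) (hl : l ≤ Fintype.card α)
    (e1 : wt L1 % 2 = 0) (w1 : wt L1 ≤ 2 * l) (e2 : wt L2 % 2 = 0) (w2 : wt L2 ≤ 2 * l) :
    Prod4 σ l := by
  obtain ⟨a, b, S1, S2, k1, k2, -, -, -, rfl⟩ := (h.perm hp).of_append
  exact ⟨a, b, dec_prod2 k1 (Nat.even_iff.2 e1) w1 h1 hl,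
    dec_prod2 k2 (Nat.even_iff.2 e2) w2 h1 hl, rfl⟩

lemma wt_eq (L : List ℕ) : wt L = L.sum + L.length := by
  induction L with
  | nil => rfl
  | cons a L ih => simp [ih]; omega

lemma wt_rep (q : ℕ) : wt (List.replicate q 2) = 3 * q := by
  rw [wt_eq]; simp; omega

lemma wt_perm {L M : List ℕ} (h : L.Perm M) : wt L = wt M := by
  rw [wt_eq, wt_eq, h.sum_eq, h.length_eq]

lemma list_norm (L : List ℕ) (h : ∀ a ∈ L, 2 ≤ a) :
    ∃ B q, L.Perm (B ++ List.replicate q 2) ∧ ∀ a ∈ B, 3 ≤ a := by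
  induction L with
  | nil => exact ⟨[], 0, by simp⟩
  | cons a L ih =>
    obtain ⟨B, q, h1, h2⟩ := ih (fun x hx => h x (by simp [hx]))
    by_cases ha : a = 2
    · subst ha
      refine ⟨B, q + 1, ?_, h2⟩
      refine (h1.cons 2).trans ?_
      rw [List.replicate_succ]
      exact List.perm_middle.symm
    · refine ⟨a :: B, q, by simpa using h1, ?_⟩
      have := h a (by simp)
      intro x hx
      rcases List.mem_cons.1 hx with rfl | hx
      · omega
      · exact h2 x hx

lemma sum_ge (k : ℕ) (L : List ℕ) (h : ∀ a ∈ L, k ≤ a) : k * L.length ≤ L.sum := by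
  have := List.card_nsmul_le_sum L k h
  simpa [mul_comm] using this

/-- special type `(4,2)` -> a cycle of length 3 and a `(2,2)` product -/
lemma dec_42 {σ : Perm α} {S : Finset α} (h : Dec σ S [4, 2]) :
    ∃ f g S1 S2 , Cyc f S1 ∧ S1.card = 3 ∧ Dec g S2 [2, 2] ∧ S1 ⊆ S ∧ S2 ⊆ S ∧ σ = f * g := by
  cases h with
  | cons hf ha h2 hs hd h3 h4 =>
    obtain ⟨f1, f2, T1, T2, x, k1, k2, k3, k4, k5, k6, k7, k8, rfl⟩ :=
      hf.split (a := 3) (b := 2) (by omega) (by omega) (by omega)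
    exact ⟨f1, _, T1, S, k1, k7, Dec.cons k2 k8 le_rfl hs (Finset.disjoint_of_subset_left k6 hd)
      (k6.trans h3) h4, k5.trans h3, Finset.Subset.refl _, by group⟩

lemma Dec.single {σ : Perm α} {S : Finset α} {a : ℕ} (h : Dec σ S [a]) :
    ∃ T, Cyc σ T ∧ T.card = a := by
  cases h with
  | cons hf ha h2 hs hd h3 h4 =>
    cases hs
    exact ⟨_, by simpa using hf, ha⟩

lemma suff {σ : Perm α} (hs : Perm.sign σ = 1) {n l : ℕ} (hn : Fintype.card α = n) (h2 : 2 ≤ l)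
    (hl : l ≤ n)
    (h : 3 * n ≤ 8 * l ∨ (n % 8 = 1 ∧ l = 3 * (n / 8)) ∨ (n = 6 ∧ l = 2)) : Prod4 σ l := by
  obtain ⟨L, hD⟩ := exists_dec σ
  have hev := Nat.even_iff.1 (hD.even hs)
  by_cases hw : wt L ≤ 2 * l
  · have h0 : Dec (1 : Perm α) ∅ [] := Dec.nil _
    exact ⟨σ, 1, dec_prod2 hD (hD.even hs) hw (by omega) (by omega),
      dec_prod2 h0 (by simp) (by simp) (by omega) (by omega), by simp⟩
  by_cases hw2 : wt L + 2 ≤ 4 * l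
  · obtain ⟨a, b, S1, S2, L1, L2, k1, k2, k3, k4, rfl, k6, k7, k8⟩ :=
      split_dec hD (2 * l) (by omega) (by omega)
    have e1 : Even (wt L1) := by
      rw [Nat.even_iff] at k7 ⊢; omega
    have sa : Perm.sign a = 1 := by rw [k1.sign, e1.neg_one_pow]
    have sb : Perm.sign b = 1 := by rw [map_mul, sa, one_mul] at hs; exact hs
    exact ⟨a, b, dec_prod2 k1 e1 k6 (by omega) (by omega),
      dec_prod2 k2 (k2.even sb) (by omega) (by omega) (by omega), rfl⟩
  have hsum : L.sum ≤ n := by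
    rw [← hn]; exact hD.sum_le.trans (Finset.card_le_univ _)
  obtain ⟨B, q, hp, hB⟩ := list_norm L hD.two_le
  have hwt := wt_perm hp
  rw [wt_append, wt_rep] at hwt
  have hsm := hp.sum_eq
  simp only [List.sum_append, List.sum_replicate, smul_eq_mul] at hsm
  have hBs := sum_ge 3 B hB
  have hBw := wt_eq B
  -- all transpositions
  have h0 : B = [] → ∀ j, l = 3 * j → wt L = 12 * j → Prod4 σ l := by
    rintro rfl j hj hj'
    simp at hwt
    refine dec_split_at hD (L1 := List.replicate (2*j) 2) (L2 := List.replicate (2*j) 2) ?_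
      (by omega) (by omega) ?_ ?_ ?_ ?_
    · rw [← List.replicate_add]
      have : 2 * j + 2 * j = q := by omega
      rw [this]; simpa using hp
    all_goals rw [wt_rep]; omega
  rcases h with h | ⟨hn8, h⟩ | ⟨h, h'⟩
  · have : B.length = 0 := by omega
    have hB0 := List.length_eq_zero_iff.1 this
    have hwt' := hwt
    have hsm' := hsm
    rw [hB0] at hwt' hsm'
    simp only [wt_nil, List.sum_nil, zero_add] at hwt' hsm'
    exact h0 hB0 (l / 3) (by omega) (by omega)
  · obtain ⟨k, rfl⟩ : ∃ k, n = 8 * k + 1 := ⟨n / 8, by omega⟩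
    have hk : l = 3 * k := by omega
    subst hk
    by_cases hB0 : B = []
    · exact h0 hB0 k rfl (by omega)
    have hspl : ∀ q1 q2, q = q1 + q2 → L.Perm ((B ++ List.replicate q1 2) ++ List.replicate q2 2) := by
      rintro q1 q2 rfl
      rw [List.append_assoc, ← List.replicate_add]; exact hp
    rcases B with _ | ⟨b1, _ | ⟨b2, _ | ⟨b3, _ | ⟨b4, B⟩⟩⟩⟩
    · simp at hB0
    · simp at hB hwt hsm hBs hBw
      refine dec_split_at hD (hspl (2 * k - 2) (2 * k) (by omega)) (by omega) (by omega) ?_ ?_ ?_ ?_ <;>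
      simp only [wt_append, wt_rep, wt_cons, wt_nil] <;> omega
    · simp at hB hwt hsm hBs hBw
      by_cases hk : k = 1
      · subst hk
        have hp' : L.Perm [3, 4, 2] := by
          have : q = 1 := by omega
          subst this
          have : (b1 = 3 ∧ b2 = 4) ∨ (b1 = 4 ∧ b2 = 3) := by omega
          rcases this with ⟨rfl, rfl⟩ | ⟨rfl, rfl⟩
          · exact hp
          · exact hp.trans (by decide)
        obtain ⟨a, b, S1, S2, g1, g2, g3, g4, g5, rfl⟩ := (hD.perm hp').of_append (L1 := [3])
        obtain ⟨T, hT, hTc⟩ := g1.single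
        obtain ⟨f, g, U1, U2, q1, q2, q3, q4, q5, rfl⟩ := dec_42 g2
        exact ⟨a * f, g, ⟨a, f, T, U1, hT, q1, hTc, q2, rfl⟩,
          dec_prod2 q3 (by decide) (by decide) (by omega) (by omega), by group⟩
      · refine dec_split_at hD (hspl (2 * k - 3) (2 * k) (by omega)) (by omega) (by omega) ?_ ?_ ?_ ?_ <;>
        simp only [wt_append, wt_rep, wt_cons, wt_nil] <;> omega
    · simp at hB hwt hsm hBs hBw
      by_cases hk : k = 1
      · subst hk
        have hp' : L.Perm [3, 3, 3] := by
          have : q = 0 := by omega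
          subst this
          have : (b1 = 3 ∧ b2 = 3 ∧ b3 = 3) := by omega
          rcases this with ⟨rfl, rfl, rfl⟩
          exact hp
        obtain ⟨a, b, S1, S2, g1, g2, g3, g4, g5, rfl⟩ := (hD.perm hp').of_append (L1 := [3])
        obtain ⟨T, hT, hTc⟩ := g1.single
        obtain ⟨a', b', S1', S2', g1', g2', g3', g4', g5', rfl⟩ := g2.of_append (L1 := [3])
        obtain ⟨T', hT', hTc'⟩ := g1'.single
        exact ⟨a * a', b', ⟨a, a', T, T', hT, hT', hTc, hTc', rfl⟩,
          dec_prod2 g2' (by decide) (by decide) (by omega) (by omega), by group⟩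
      · refine dec_split_at hD (hspl (2 * k - 4) (2 * k) (by omega)) (by omega) (by omega) ?_ ?_ ?_ ?_ <;>
        simp only [wt_append, wt_rep, wt_cons, wt_nil] <;> omega
    · simp only [List.length_cons, List.sum_cons] at hBs hBw hsm
      omega
  · subst h h'
    rcases B with _ | ⟨b1, _ | ⟨b2, _ | ⟨b3, B⟩⟩⟩
    · simp at hwt; omega
    · simp at hB hwt hsm hBs hBw
      have hb : b1 = 4 := by omega
      have : q = 1 := by omega
      subst this hb
      obtain ⟨f, g, U1, U2, q1, q2, q3, q4, q5, rfl⟩ := dec_42 (hD.perm hp)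
      obtain ⟨a', b', S1', S2', g1', g2', g3', g4', g5', rfl⟩ := q3.of_append (L1 := [2])
      obtain ⟨T, hT, hTc⟩ := g1'.single
      obtain ⟨T', hT', hTc'⟩ := g2'.single
      exact ⟨f, a' * b', dec_prod2 (q1.dec q2 (by omega)) (by decide) (by decide) (by omega) (by omega),
        ⟨a', b', T, T', hT, hT', hTc, hTc', rfl⟩, rfl⟩
    · simp at hB hwt hsm hBs hBw
      have : q = 0 := by omega
      subst this
      refine dec_split_at hD (L1 := [b1]) (L2 := [b2]) (by simpa using hp) (by omega) (by omega) ?_ ?_ ?_ ?_ <;>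
      simp <;> omega
    · simp only [List.length_cons, List.sum_cons] at hBs hBw hsm
      omega

end cyc


set_option linter.unusedSectionVars false
set_option linter.unnecessarySimpa false
section lin
variable {α : Type*} [DecidableEq α] [Fintype α]

/-- functions invariant under `σ` -/
def InvF (σ : Perm α) : Submodule ℚ (α → ℚ) where
  carrier := {f | ∀ x, f (σ x) = f x}
  add_mem' := by intro f g hf hg x; simp [hf x, hg x]
  zero_mem' := by intro x; simp
  smul_mem' := by intro c f hf x; simp [hf x]

def Dif (σ : Perm α) : (α → ℚ) →ₗ[ℚ] (α → ℚ) where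
  toFun f := fun x => f (σ x) - f x
  map_add' := by intro f g; ext x; simp; ring
  map_smul' := by intro c f; ext x; simp; ring

lemma mem_InvF {σ : Perm α} {f : α → ℚ} : f ∈ InvF σ ↔ ∀ x, f (σ x) = f x := Iff.rfl

/-- functions constant on `U` -/
def Cst (U : Finset α) : Submodule ℚ (α → ℚ) where
  carrier := {f | ∀ x ∈ U, ∀ y ∈ U, f x = f y}
  add_mem' := by intro f g hf hg x hx y hy; simp [hf x hx y hy, hg x hx y hy]
  zero_mem' := by intro x; simp
  smul_mem' := by intro c f hf x hx y hy; simp [hf x hx y hy]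

lemma mem_Cst {U : Finset α} {f : α → ℚ} : f ∈ Cst U ↔ ∀ x ∈ U, ∀ y ∈ U, f x = f y := Iff.rfl

open Module

lemma orth {σ : Perm α} {f g : α → ℚ} (hf : f ∈ InvF σ) (hg : g ∈ LinearMap.range (Dif σ)) :
    ∑ x, f x * g x = 0 := by
  obtain ⟨h, rfl⟩ := hg
  have : ∀ x, f x * (Dif σ h) x = f (σ x) * h (σ x) - f x * h x := by
    intro x
    have := mem_InvF.1 hf x
    simp [Dif, this]; ring
  rw [Finset.sum_congr rfl (fun x _ => this x), Finset.sum_sub_distrib,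
    Equiv.sum_comp σ (fun x => f x * h x), sub_self]

lemma step_lem (τ σ : Perm α) (F : Submodule ℚ (α → ℚ)) (hF : F ≤ InvF σ) :
    finrank ℚ (InvF (τ * σ)) + finrank ℚ (InvF τ) + 2 * finrank ℚ F ≤
      finrank ℚ (InvF σ) + Fintype.card α + 2 * finrank ℚ (F ⊓ InvF τ : Submodule ℚ (α → ℚ)) := by
  -- rank-nullity
  set R : Submodule ℚ (α → ℚ) := LinearMap.range (Dif τ) ⊓ LinearMap.range (Dif σ) with hR
  have h1 : finrank ℚ (InvF (τ * σ)) ≤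
      finrank ℚ (InvF σ ⊓ InvF τ : Submodule ℚ (α → ℚ)) + finrank ℚ R := by
    have hrn := LinearMap.finrank_range_add_finrank_ker ((Dif τ).comp (InvF (τ * σ)).subtype)
    have ha : finrank ℚ (LinearMap.range ((Dif τ).comp (InvF (τ * σ)).subtype)) ≤ finrank ℚ R := by
      apply Submodule.finrank_mono
      rintro _ ⟨⟨f, hf⟩, rfl⟩
      refine ⟨⟨f, rfl⟩, ⟨fun x => - f (τ x), ?_⟩⟩
      ext x
      have := mem_InvF.1 hf x
      simp only [Perm.mul_apply] at this
      simp [Dif, this]; ring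
    have hb : finrank ℚ (LinearMap.ker ((Dif τ).comp (InvF (τ * σ)).subtype)) ≤
        finrank ℚ (InvF σ ⊓ InvF τ : Submodule ℚ (α → ℚ)) := by
      rw [← Submodule.finrank_map_subtype_eq]
      apply Submodule.finrank_mono
      rintro _ ⟨⟨f, hf⟩, hk, rfl⟩
      have hτ : ∀ x, f (τ x) = f x := by
        intro x
        have := congrFun (LinearMap.mem_ker.1 hk) x
        simpa [Dif, sub_eq_zero] using this
      refine ⟨fun x => ?_, hτ⟩
      have := mem_InvF.1 hf x
      rw [Perm.mul_apply, hτ] at this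
      exact this
    omega
  have h2 : finrank ℚ (InvF σ ⊔ InvF τ : Submodule ℚ (α → ℚ)) + finrank ℚ R ≤ Fintype.card α := by
    have := Submodule.finrank_add_finrank_le_of_disjoint (s := (InvF σ ⊔ InvF τ : Submodule ℚ (α → ℚ))) (t := R) ?_
    · simpa using this
    rw [Submodule.disjoint_def]
    intro f hf hfR
    obtain ⟨g, hg, h, hh, rfl⟩ := Submodule.mem_sup.1 hf
    have e1 := orth hg hfR.2
    have e2 := orth hh hfR.1
    have e3 : ∑ x, (g + h) x * (g + h) x = 0 := by
      rw [← add_zero (0 : ℚ)]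
      nth_rw 1 [← e1]
      rw [← e2, ← Finset.sum_add_distrib]
      apply Finset.sum_congr rfl
      intro x _
      simp; ring
    rw [Finset.sum_eq_zero_iff_of_nonneg (fun x _ => mul_self_nonneg _)] at e3
    ext x
    simpa using e3 x (Finset.mem_univ x)
  have h3 : finrank ℚ (F ⊔ InvF τ : Submodule ℚ (α → ℚ)) ≤ finrank ℚ (InvF σ ⊔ InvF τ : Submodule ℚ (α → ℚ)) :=
    Submodule.finrank_mono (sup_le_sup_right hF _)
  have h4 := Submodule.finrank_sup_add_finrank_inf_eq F (InvF τ)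
  have h5 := Submodule.finrank_sup_add_finrank_inf_eq F (InvF σ ⊓ InvF τ)
  have h6 : F ⊓ (InvF σ ⊓ InvF τ) = F ⊓ InvF τ := by
    rw [← inf_assoc, inf_eq_left.2 hF]
  have h7 : finrank ℚ (F ⊔ (InvF σ ⊓ InvF τ) : Submodule ℚ (α → ℚ)) ≤ finrank ℚ (InvF σ) :=
    Submodule.finrank_mono (sup_le hF inf_le_left)
  rw [h6] at h5
  omega

def Fx : List (Perm α) → Submodule ℚ (α → ℚ)
  | [] => ⊤
  | c :: L => Fx L ⊓ InvF c

lemma Fx_le (L : List (Perm α)) : Fx L ≤ InvF L.prod := by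
  induction L with
  | nil => intro f _ x; simp
  | cons c L ih =>
    rintro f ⟨h1, h2⟩ x
    rw [List.prod_cons, Perm.mul_apply, mem_InvF.1 h2, mem_InvF.1 (ih h1)]

lemma genus (L : List (Perm α)) :
    Fintype.card α + finrank ℚ (InvF L.prod) + (L.map (fun c => finrank ℚ (InvF c))).sum ≤
      Fintype.card α * L.length + 2 * finrank ℚ (Fx L) := by
  induction L with
  | nil =>
    have : InvF (1 : Perm α) = ⊤ := by ext f; simp [mem_InvF]
    have h2 : Fx ([] : List (Perm α)) = ⊤ := rfl
    rw [h2, List.prod_nil, this, finrank_top]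
    simp; omega
  | cons c L ih =>
    have := step_lem c L.prod (Fx L) (Fx_le L)
    have h2 : Fx (c :: L) = Fx L ⊓ InvF c := rfl
    rw [h2, List.prod_cons, List.map_cons, List.sum_cons, List.length_cons, mul_add, mul_one]
    omega

lemma Cst_lower (U : Finset α) : Fintype.card α + 1 ≤ finrank ℚ (Cst U) + U.card ∨ U = ∅ := by
  rcases U.eq_empty_or_nonempty with h | ⟨x0, hx0⟩
  · exact Or.inr h
  left
  let φ : (α → ℚ) →ₗ[ℚ] ({x // x ∈ U.erase x0} → ℚ) :=
    { toFun := fun f x => f x - f x0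
      map_add' := by intro f g; ext x; simp; ring
      map_smul' := by intro c f; ext x; simp; ring }
  have h1 := LinearMap.finrank_range_add_finrank_ker φ
  have h2 : finrank ℚ (LinearMap.range φ) ≤ U.card - 1 := by
    refine (Submodule.finrank_le _).trans ?_
    rw [Module.finrank_fintype_fun_eq_card, Fintype.card_coe, Finset.card_erase_of_mem hx0]
  have h3 : LinearMap.ker φ ≤ Cst U := by
    intro f hf
    have key : ∀ x ∈ U, f x = f x0 := by
      intro x hx
      by_cases h : x = x0
      · rw [h]
      · have := congrFun (LinearMap.mem_ker.1 hf) ⟨x, Finset.mem_erase.2 ⟨h, hx⟩⟩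
        simpa [φ, sub_eq_zero] using this
    intro x hx y hy
    rw [key x hx, key y hy]
  have h4 := Submodule.finrank_mono h3
  have h5 : 0 < U.card := Finset.card_pos.2 ⟨x0, hx0⟩
  simp at h1
  omega

lemma Cst_upper {U : Finset α} (hU : U.Nonempty) : finrank ℚ (Cst U) + U.card ≤ Fintype.card α + 1 := by
  obtain ⟨x0, hx0⟩ := hU
  let W : Finset α := insert x0 Uᶜ
  let φ : Cst U →ₗ[ℚ] ({x // x ∈ W} → ℚ) :=
    { toFun := fun f x => f.1 x
      map_add' := by intro f g; ext x; simp
      map_smul' := by intro c f; ext x; simp }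
  have hinj : Function.Injective φ := by
    rintro ⟨f, hf⟩ ⟨g, hg⟩ h
    ext x
    have h' : ∀ y ∈ W, f y = g y := fun y hy => congrFun h ⟨y, hy⟩
    by_cases hx : x ∈ U
    · have := h' x0 (by simp [W])
      simp only
      rw [hf x hx x0 hx0, hg x hx x0 hx0, this]
    · exact h' x (by simp [W, hx])
  have h1 := LinearMap.finrank_le_finrank_of_injective hinj
  have h2 : W.card = Uᶜ.card + 1 := Finset.card_insert_of_notMem (by simp [hx0])
  have h3 := Finset.card_compl U
  have h4 := Finset.card_le_univ U
  simp at h1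
  omega

lemma InvF_cycle {c : Perm α} (hc : c.IsCycle) :
    Fintype.card α + 1 ≤ finrank ℚ (InvF c) + c.support.card := by
  have h1 : Cst c.support ≤ InvF c := by
    intro f hf x
    by_cases h : x ∈ c.support
    · exact hf _ (by simpa using h) _ h
    · rw [Perm.notMem_support.1 h]
  have h2 := Submodule.finrank_mono h1
  rcases Cst_lower c.support with h | h
  · omega
  · have := hc.two_le_card_support
    rw [h] at this; simp at this

lemma InvF_lower (σ : Perm α) :
    Fintype.card α + σ.cycleType.card ≤ finrank ℚ (InvF σ) + σ.support.card := by
  induction σ using Perm.cycle_induction_on with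
  | base_one =>
    have : InvF (1 : Perm α) = ⊤ := by ext f; simp [mem_InvF]
    rw [this, finrank_top]; simp
  | base_cycles f hf =>
    have := InvF_cycle hf
    rw [hf.cycleType]; simpa using this
  | induction_disjoint f g hd hc h1 h2 =>
    rw [hd.cycleType_mul, hd.card_support_mul, Multiset.card_add]
    have h3 := Submodule.finrank_sup_add_finrank_inf_eq (InvF f) (InvF g)
    have h4 : finrank ℚ (InvF f ⊔ InvF g : Submodule ℚ (α → ℚ)) ≤ Fintype.card α := by
      simpa using Submodule.finrank_le (InvF f ⊔ InvF g : Submodule ℚ (α → ℚ))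
    have h5 : InvF f ⊓ InvF g ≤ InvF (f * g) := by
      rintro u ⟨hu, hv⟩ x
      rw [Perm.mul_apply, mem_InvF.1 hu, mem_InvF.1 hv]
    have h6 := Submodule.finrank_mono h5
    omega

lemma const_on_cycle {c : Perm α} (hc : c.IsCycle) {f : α → ℚ} (hf : f ∈ InvF c) :
    f ∈ Cst c.support := by
  have key : ∀ x (k : ℤ), f ((c ^ k) x) = f x := by
    intro x k
    have h1 : ∀ x, f (c⁻¹ x) = f x := by
      intro x; have := mem_InvF.1 hf (c⁻¹ x); simpa using this.symm
    induction k using Int.induction_on generalizing x with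
    | zero => simp
    | succ i ih => rw [zpow_add_one, Perm.mul_apply, ih, mem_InvF.1 hf]
    | pred i ih => rw [zpow_sub_one, Perm.mul_apply, ih, h1]
  intro x hx y hy
  obtain ⟨k, rfl⟩ := hc.sameCycle (Perm.mem_support.1 hx) (Perm.mem_support.1 hy)
  rw [key]

/-- main inequality for a "connected" list of `l`-cycles -/
lemma genus_conn (L : List (Perm α)) (l : ℕ) (h2 : 2 ≤ l) (hL : L ≠ [])
    (hc : ∀ c ∈ L, c.IsCycle ∧ c.support.card = l)
    (hconn : ∃ x0, ∀ f : α → ℚ, (∀ c ∈ L, f ∈ Cst c.support) → ∀ c ∈ L, ∀ x ∈ c.support, f x = f x0) :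
    L.prod.support.card + L.prod.cycleType.card + L.length ≤ l * L.length + 2 := by
  obtain ⟨x0, hconn⟩ := hconn
  set U : Finset α := Finset.univ.filter (fun x => ∃ c ∈ L, x ∈ c.support) with hU
  have hne : U.Nonempty := by
    obtain ⟨c, hcL⟩ := List.exists_mem_of_ne_nil L hL
    have : 0 < c.support.card := by rw [(hc c hcL).2]; omega
    obtain ⟨x, hx⟩ := Finset.card_pos.1 this
    exact ⟨x, by simp only [hU, Finset.mem_filter, Finset.mem_univ, true_and]; exact ⟨c, hcL, hx⟩⟩
  have hsub : L.prod.support ⊆ U := by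
    intro x hx
    by_contra hxU
    simp only [hU, Finset.mem_filter, Finset.mem_univ, true_and, not_exists, not_and] at hxU
    apply Perm.mem_support.1 hx
    clear * - hxU
    induction L with
    | nil => simp
    | cons c L ih =>
      rw [List.prod_cons, Perm.mul_apply, ih (fun d hd => hxU d (by simp [hd]))]
      exact Perm.notMem_support.1 (hxU c (by simp))
  have hFx : ∀ f ∈ Fx L, ∀ c ∈ L, f ∈ InvF c := by
    clear * -
    induction L with
    | nil => simp
    | cons c L ih =>
      rintro f ⟨h1, h2⟩ d hd
      rcases List.mem_cons.1 hd with rfl | hd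
      · exact h2
      · exact ih f h1 d hd
  have hF : Fx L ≤ Cst U := by
    intro f hf
    have key : ∀ x ∈ U, f x = f x0 := by
      intro x hx
      simp only [hU, Finset.mem_filter, Finset.mem_univ, true_and] at hx
      obtain ⟨c, hcL, hx⟩ := hx
      exact hconn f (fun c hcL => const_on_cycle (hc c hcL).1 (hFx f hf c hcL)) c hcL x hx
    intro x hx y hy
    rw [key x hx, key y hy]
  have e1 := Submodule.finrank_mono hF
  have e2 := Cst_upper hne
  have e3 := Finset.card_le_card hsub
  have e4 := InvF_lower L.prod
  have e5 := genus L
  have e6 : (Fintype.card α + 1) * L.length ≤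
      (L.map (fun c => finrank ℚ (InvF c))).sum + l * L.length := by
    clear * - hc
    induction L with
    | nil => simp
    | cons c L ih =>
      have h1 := ih (fun d hd => hc d (by simp [hd]))
      have h2 := hc c (by simp)
      have h3 := InvF_cycle h2.1
      rw [h2.2] at h3
      simp only [List.map_cons, List.sum_cons, List.length_cons, mul_add, mul_one]
      omega
  rw [add_mul, one_mul] at e6
  omega

end lin

section nec
variable {α : Type*} [DecidableEq α] [Fintype α]

lemma pair_bound {l : ℕ} (h2 : 2 ≤ l) {c d : Perm α} (hc : c.IsCycle ∧ c.support.card = l)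
    (hd : d.IsCycle ∧ d.support.card = l) (h : ¬ Perm.Disjoint c d) :
    (c * d).cycleType.sum + (c * d).cycleType.card ≤ 2 * l := by
  rw [Perm.disjoint_iff_disjoint_support, Finset.not_disjoint_iff] at h
  obtain ⟨x, hx1, hx2⟩ := h
  have := genus_conn [c, d] l h2 (by simp) (by simp [hc, hd]) ⟨x, by
    intro f hf e he y hy
    simp only [List.mem_cons, List.not_mem_nil, or_false] at he
    rcases he with rfl | rfl
    · exact hf e (by simp) y hy x hx1
    · exact hf e (by simp) y hy x hx2⟩
  rw [Perm.sum_cycleType]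
  simp at this ⊢
  omega

lemma iso_mem {l : ℕ} {c d : Perm α} (hc : c.IsCycle ∧ c.support.card = l)
    (h : Perm.Disjoint c d) : l ∈ (c * d).cycleType := by
  rw [h.cycleType_mul, hc.1.cycleType, hc.2]; simp

lemma classify {l : ℕ} (h2 : 2 ≤ l) {c1 c2 c3 c4 : Perm α}
    (h1 : c1.IsCycle ∧ c1.support.card = l) (h2' : c2.IsCycle ∧ c2.support.card = l)
    (h3 : c3.IsCycle ∧ c3.support.card = l) (h4 : c4.IsCycle ∧ c4.support.card = l)
    {σ : Perm α} (hσ : σ = c1 * c2 * (c3 * c4)) :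
    l ∈ σ.cycleType ∨ σ.cycleType.sum + σ.cycleType.card + 2 ≤ 4 * l ∨
    ∃ A B : Multiset ℕ, σ.cycleType = A + B ∧ A.sum + A.card ≤ 2 * l ∧ B.sum + B.card ≤ 2 * l := by
  by_cases hl : l ∈ σ.cycleType
  · exact Or.inl hl
  right
  have I1 : ¬ (Perm.Disjoint c1 c2 ∧ Perm.Disjoint c1 c3 ∧ Perm.Disjoint c1 c4) := by
    rintro ⟨a, b, c⟩
    apply hl
    rw [hσ, mul_assoc]
    exact iso_mem h1 (a.mul_right (b.mul_right c))
  have I2 : ¬ (Perm.Disjoint c1 c2 ∧ Perm.Disjoint c2 c3 ∧ Perm.Disjoint c2 c4) := by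
    rintro ⟨a, b, c⟩
    apply hl
    rw [hσ, a.commute.eq, mul_assoc]
    exact iso_mem h2' (a.symm.mul_right (b.mul_right c))
  have I3 : ¬ (Perm.Disjoint c1 c3 ∧ Perm.Disjoint c2 c3 ∧ Perm.Disjoint c3 c4) := by
    rintro ⟨a, b, c⟩
    apply hl
    have : c1 * c2 * (c3 * c4) = c3 * (c1 * c2 * c4) := by
      have e := (a.symm.mul_right b.symm).commute.eq
      rw [← mul_assoc, ← e]; group
    rw [hσ, this]
    exact iso_mem h3 ((a.symm.mul_right b.symm).mul_right c)
  have I4 : ¬ (Perm.Disjoint c1 c4 ∧ Perm.Disjoint c2 c4 ∧ Perm.Disjoint c3 c4) := by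
    rintro ⟨a, b, c⟩
    apply hl
    have : c1 * c2 * (c3 * c4) = c4 * (c1 * c2 * c3) := by
      have e := ((a.symm.mul_right b.symm).mul_right c.symm).commute.eq
      rw [e]; group
    rw [hσ, this]
    exact iso_mem h4 ((a.symm.mul_right b.symm).mul_right c.symm)
  by_cases P1 : Perm.Disjoint c1 c3 ∧ Perm.Disjoint c1 c4 ∧ Perm.Disjoint c2 c3 ∧ Perm.Disjoint c2 c4
  · obtain ⟨a, b, c, d⟩ := P1
    right
    refine ⟨_, _, ?_, pair_bound h2 h1 h2' (fun h => I1 ⟨h, a, b⟩), pair_bound h2 h3 h4 (fun h => I3 ⟨a, c, h⟩)⟩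
    rw [hσ, ((a.mul_right b).mul_left (c.mul_right d)).cycleType_mul]
  by_cases P2 : Perm.Disjoint c1 c2 ∧ Perm.Disjoint c1 c4 ∧ Perm.Disjoint c2 c3 ∧ Perm.Disjoint c3 c4
  · obtain ⟨a, b, c, d⟩ := P2
    right
    refine ⟨_, _, ?_, pair_bound h2 h1 h3 (fun h => I1 ⟨a, h, b⟩), pair_bound h2 h2' h4 (fun h => I2 ⟨a, c, h⟩)⟩
    have : c1 * c2 * (c3 * c4) = c1 * c3 * (c2 * c4) := by
      have e := c.commute.eq
      rw [mul_assoc, ← mul_assoc c2, e]; group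
    rw [hσ, this, ((a.mul_right b).mul_left (c.symm.mul_right d)).cycleType_mul]
  by_cases P3 : Perm.Disjoint c1 c2 ∧ Perm.Disjoint c1 c3 ∧ Perm.Disjoint c2 c4 ∧ Perm.Disjoint c3 c4
  · obtain ⟨a, b, c, d⟩ := P3
    right
    refine ⟨_, _, ?_, pair_bound h2 h1 h4 (fun h => I1 ⟨a, b, h⟩), pair_bound h2 h2' h3 (fun h => I2 ⟨a, h, c⟩)⟩
    have : c1 * c2 * (c3 * c4) = c1 * c4 * (c2 * c3) := by
      have e := (c.mul_left d).commute.eq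
      rw [mul_assoc, mul_assoc c1, ← e]; group
    rw [hσ, this, ((a.mul_right b).mul_left (c.symm.mul_right d.symm)).cycleType_mul]
  left
  have ne : ∀ c : Perm α, c.IsCycle ∧ c.support.card = l → ∃ x, x ∈ c.support := by
    intro c hc
    exact Finset.card_pos.1 (by rw [hc.2]; omega)
  obtain ⟨x1, hx1⟩ := ne c1 h1
  obtain ⟨x2, hx2⟩ := ne c2 h2'
  obtain ⟨x3, hx3⟩ := ne c3 h3
  obtain ⟨x4, hx4⟩ := ne c4 h4
  have E : ∀ (c d : Perm α) (x y : α) (f : α → ℚ), x ∈ c.support → y ∈ d.support →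
      f ∈ Cst c.support → f ∈ Cst d.support → Perm.Disjoint c d ∨ f x = f y := by
    intro c d x y f hx hy hc hd
    by_cases h : Perm.Disjoint c d
    · exact Or.inl h
    · right
      rw [Perm.disjoint_iff_disjoint_support, Finset.not_disjoint_iff] at h
      obtain ⟨z, hz1, hz2⟩ := h
      rw [hc x hx z hz1, hd z hz2 y hy]
  have := genus_conn [c1, c2, c3, c4] l h2 (by simp) (by simp [h1, h2', h3, h4]) ⟨x1, by
    intro f hf
    have f1 := hf c1 (by simp)
    have f2 := hf c2 (by simp)
    have f3 := hf c3 (by simp)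
    have f4 := hf c4 (by simp)
    have e12 := E c1 c2 x1 x2 f hx1 hx2 f1 f2
    have e13 := E c1 c3 x1 x3 f hx1 hx3 f1 f3
    have e14 := E c1 c4 x1 x4 f hx1 hx4 f1 f4
    have e23 := E c2 c3 x2 x3 f hx2 hx3 f2 f3
    have e24 := E c2 c4 x2 x4 f hx2 hx4 f2 f4
    have e34 := E c3 c4 x3 x4 f hx3 hx4 f3 f4
    have key : f x2 = f x1 ∧ f x3 = f x1 ∧ f x4 = f x1 := by
      clear * - e12 e13 e14 e23 e24 e34 I1 I2 I3 I4 P1 P2 P3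
      grind
    intro e he y hy
    simp only [List.mem_cons, List.not_mem_nil, or_false] at he
    rcases he with rfl | rfl | rfl | rfl
    · exact f1 y hy x1 hx1
    · rw [f2 y hy x2 hx2, key.1]
    · rw [f3 y hy x3 hx3, key.2.1]
    · rw [f4 y hy x4 hx4, key.2.2]⟩
  have hp : [c1, c2, c3, c4].prod = σ := by rw [hσ]; simp [mul_assoc]
  rw [hp] at this
  rw [Perm.sum_cycleType]
  simp at this ⊢
  omega

lemma split_rep {s p : ℕ} {A B : Multiset ℕ} (h : s ::ₘ Multiset.replicate p 2 = A + B) :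
    ∃ q ≤ p, A.sum + A.card = 3 * q ∨ B.sum + B.card = 3 * q := by
  have aux : ∀ A B : Multiset ℕ, s ::ₘ Multiset.replicate p 2 = A + B → s ∈ A →
      ∃ q ≤ p, B.sum + B.card = 3 * q := by
    intro A B h hs
    obtain ⟨A', rfl⟩ := Multiset.exists_cons_of_mem hs
    rw [Multiset.cons_add, Multiset.cons_inj_right] at h
    have hle : B ≤ Multiset.replicate p 2 := by rw [h]; exact Multiset.le_add_left _ _
    obtain ⟨q, hq, rfl⟩ := Multiset.le_replicate_iff.1 hle
    exact ⟨q, hq, by simp; omega⟩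
  have hs : s ∈ A + B := by rw [← h]; simp
  rcases Multiset.mem_add.1 hs with hs | hs
  · obtain ⟨q, h1, h2⟩ := aux A B h hs
    exact ⟨q, h1, Or.inr h2⟩
  · obtain ⟨q, h1, h2⟩ := aux B A (by rw [h, add_comm]) hs
    exact ⟨q, h1, Or.inl h2⟩

lemma nec_core {n l s p : ℕ} (hn : Fintype.card α = n) (h2 : 2 ≤ l) (hs : 2 ≤ s)
    (hsum : s + 2 * p ≤ n) (hev : (s + 1 + 3 * p) % 2 = 0) (hls : l ≠ s) (hl2 : p = 0 ∨ l ≠ 2)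
    (hw : 4 * l < s + 1 + 3 * p + 2)
    (hq : ∀ q ≤ p, 3 * q ≤ 2 * l → 2 * l + 3 * q < s + 1 + 3 * p) :
    ∃ σ : Perm α, Perm.sign σ = 1 ∧ ¬ Prod4 σ l := by
  obtain ⟨σ, hσ⟩ := (Perm.exists_with_cycleType_iff α (m := s ::ₘ Multiset.replicate p 2)).2 (by
    constructor
    · simp; omega
    · intro a ha
      rcases Multiset.mem_cons.1 ha with rfl | ha
      · exact hs
      · rw [Multiset.eq_of_mem_replicate ha])
  refine ⟨σ, ?_, ?_⟩
  · rw [Perm.sign_of_cycleType, hσ]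
    apply Even.neg_one_pow
    rw [Nat.even_iff]
    simp; omega
  · rintro ⟨a, b, ⟨c1, c2, S1, S2, k1, k2, e1, e2, rfl⟩, ⟨c3, c4, S3, S4, k3, k4, e3, e4, rfl⟩, h⟩
    have i : ∀ (c : Perm α) (S : Finset α), Cyc c S → S.card = l → c.IsCycle ∧ c.support.card = l := by
      intro c S hc hS
      obtain ⟨q1, q2⟩ := hc.isCycle (by omega)
      exact ⟨q1, by rw [q2, hS]⟩
    rcases classify h2 (i _ _ k1 e1) (i _ _ k2 e2) (i _ _ k3 e3) (i _ _ k4 e4) h with g | g | ⟨A, B, g1, g2, g3⟩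
    · rw [hσ] at g
      rcases Multiset.mem_cons.1 g with g | g
      · exact hls g
      · rw [Multiset.mem_replicate] at g
        omega
    · rw [hσ] at g
      simp at g
      omega
    · rw [hσ] at g1
      have hws : s + 1 + 3 * p = (A.sum + A.card) + (B.sum + B.card) := by
        have := congrArg Multiset.sum g1
        have h' := congrArg Multiset.card g1
        simp at this h'
        omega
      obtain ⟨q, hqp, hh⟩ := split_rep g1
      have := hq q hqp
      omega

lemma nec {n l : ℕ} (hn : Fintype.card α = n) (h2 : 2 ≤ l)
    (h : ∀ σ : Perm α, Perm.sign σ = 1 → Prod4 σ l) (hl : l ≤ n) :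
    (n % 8 ≠ 1 ∧ (3 * n + 7) / 8 ≤ l ∧ l ≤ n) ∨
      (n % 8 = 1 ∧ 3 * n / 8 ≤ l ∧ l ≤ n) ∨ (n = 6 ∧ l = 2) := by
  by_contra hcon
  have go : ∀ m s p : ℕ, l ≤ m → m ≤ n → 2 ≤ s → s + 2 * p ≤ n → (s + 1 + 3 * p) % 2 = 0 →
      m ≠ s → (p = 0 ∨ m ≠ 2) → (4 * m < s + 1 + 3 * p + 2) →
      (∀ q ≤ p, 3 * q ≤ 2 * m → 2 * m + 3 * q < s + 1 + 3 * p) → False := by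
    intro m s p a1 a2 a3 a4 a5 a6 a7 a8 a9
    obtain ⟨σ, q1, q2⟩ := nec_core hn (h2.trans a1) a3 a4 a5 a6 a7 a8 a9
    exact q2 ((h σ q1).mono a1 (by omega))
  obtain ⟨k, r, hr, rfl⟩ : ∃ k r, r < 8 ∧ n = 8 * k + r := ⟨n / 8, n % 8, by omega, by omega⟩
  by_cases hsm : 8 * k + r = 7 ∨ 8 * k + r = 8 ∨ 8 * k + r = 9
  · exact go 2 7 0 (by omega) (by omega) (by omega) (by omega) (by omega) (by omega) (by omega)
      (by omega) (by intro q hq; omega)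
  have hc : r = 0 ∨ r = 1 ∨ r = 2 ∨ r = 3 ∨ r = 4 ∨ r = 5 ∨ r = 6 ∨ r = 7 := by omega
  rcases hc with rfl | rfl | rfl | rfl | rfl | rfl | rfl | rfl
  · exact go (3 * k - 1) 2 (4 * k - 1) (by omega) (by omega) (by omega) (by omega) (by omega)
      (by omega) (by omega) (by omega) (by intro q hq; omega)
  · exact go (3 * k - 1) 2 (4 * k - 1) (by omega) (by omega) (by omega) (by omega) (by omega)
      (by omega) (by omega) (by omega) (by intro q hq; omega)
  · exact go (3 * k) 4 (4 * k - 1) (by omega) (by omega) (by omega) (by omega) (by omega)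
      (by omega) (by omega) (by omega) (by intro q hq; omega)
  · exact go (3 * k + 1) 3 (4 * k) (by omega) (by omega) (by omega) (by omega) (by omega)
      (by omega) (by omega) (by omega) (by intro q hq; omega)
  · exact go (3 * k + 1) 2 (4 * k + 1) (by omega) (by omega) (by omega) (by omega) (by omega)
      (by omega) (by omega) (by omega) (by intro q hq; omega)
  · exact go (3 * k + 1) 2 (4 * k + 1) (by omega) (by omega) (by omega) (by omega) (by omega)
      (by omega) (by omega) (by omega) (by intro q hq; omega)
  · exact go (3 * k + 2) 4 (4 * k + 1) (by omega) (by omega) (by omega) (by omega) (by omega)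
      (by omega) (by omega) (by omega) (by intro q hq; omega)
  · exact go (3 * k + 2) 3 (4 * k + 2) (by omega) (by omega) (by omega) (by omega) (by omega)
      (by omega) (by omega) (by omega) (by intro q hq; omega)

end nec

lemma isProd_iff {n l : ℕ} (hl : 2 ≤ l) (σ : Perm (Fin n)) :
    IsProdOfCycles n 4 l σ ↔ Prod4 σ l := by
  constructor
  · rintro ⟨c, hc, rfl⟩
    refine ⟨c 0 * c 1, c 2 * c 3, ⟨_, _, _, _, cyc_of_isCycle (hc 0).1, cyc_of_isCycle (hc 1).1,
      (hc 0).2, (hc 1).2, rfl⟩, ⟨_, _, _, _, cyc_of_isCycle (hc 2).1, cyc_of_isCycle (hc 3).1,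
      (hc 2).2, (hc 3).2, rfl⟩, ?_⟩
    simp [List.ofFn_succ, mul_assoc]
  · rintro ⟨a, b, ⟨c1, c2, S1, S2, k1, k2, e1, e2, rfl⟩, ⟨c3, c4, S3, S4, k3, k4, e3, e4, rfl⟩, h⟩
    have i : ∀ (c : Perm (Fin n)) (S : Finset (Fin n)), Cyc c S → S.card = l →
        c.IsCycle ∧ c.support.card = l := by
      intro c S hc hS
      obtain ⟨q1, q2⟩ := hc.isCycle (by omega)
      exact ⟨q1, by rw [q2, hS]⟩
    refine ⟨![c1, c2, c3, c4], ?_, ?_⟩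
    · intro j
      fin_cases j
      · exact i _ _ k1 e1
      · exact i _ _ k2 e2
      · exact i _ _ k3 e3
      · exact i _ _ k4 e4
    · rw [h]; simp [List.ofFn_succ, mul_assoc]

theorem product_of_four_l_cycles_iff (n l : ℕ) (hn : 2 ≤ n) (hl : 2 ≤ l) :
    (∀ σ ∈ alternatingGroup (Fin n), IsProdOfCycles n 4 l σ) ↔
      (n % 8 ≠ 1 ∧ (3 * n + 7) / 8 ≤ l ∧ l ≤ n) ∨
      (n % 8 = 1 ∧ 3 * n / 8 ≤ l ∧ l ≤ n) ∨
      (n = 6 ∧ l = 2) := by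
  constructor
  · intro h
    have hln : l ≤ n := by
      obtain ⟨c, hc, -⟩ := h 1 (one_mem _)
      have := Finset.card_le_univ (c 0).support
      rw [(hc 0).2] at this
      simpa using this
    exact nec (α := Fin n) (by simp) hl
      (fun σ hs => (isProd_iff hl σ).1 (h σ (Perm.mem_alternatingGroup.2 hs))) hln
  · intro h σ hσ
    rw [isProd_iff hl]
    exact suff (Perm.mem_alternatingGroup.1 hσ) (n := n) (by simp) hl (by omega) (by omega)
end
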